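/- arXiv:1606.04628 — 11 statements merged into one kernel-verified Lean document; each statement's English description precedes it below -/
import Mathlib

section
/- Let (X,ρ) be a K-quasi-metric space (K ≥ 1) and let 0 < ε ≤ 1 be a constant such that K^ε ≤ 2. Then there exists a metric d on X such that (1/4)·ρ(z₁,z₂)^ε ≤ d(z₁,z₂) ≤ ρ(z₁,z₂)^ε for all z₁, z₂ ∈ X. -/
open Filter Topology

universe u v

/-- `ρ` is a `K`-quasi-metric on `Z`: nonnegative, vanishing exactly on the diagonal,
symmetric, and satisfying `ρ(x,z) ≤ K·max(ρ(x,y), ρ(y,z))`. -/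
def IsQuasiMetric {Z : Type*} (K : ℝ) (ρ : Z → Z → ℝ) : Prop :=
  (∀ x y : Z, 0 ≤ ρ x y) ∧ (∀ x y : Z, ρ x y = 0 ↔ x = y) ∧
    (∀ x y : Z, ρ x y = ρ y x) ∧ (∀ x y z : Z, ρ x z ≤ K * max (ρ x y) (ρ y z))

/-- `(Z,ρ)` is `μ`-uniformly perfect. -/
def UniformlyPerfectWith {Z : Type*} (ρ : Z → Z → ℝ) (μ : ℝ) : Prop :=
  ∀ x : Z, ∀ r : ℝ, 0 < r → (∃ z : Z, r ≤ ρ x z) →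
    ∃ y : Z, μ * r ≤ ρ x y ∧ ρ x y < r

/-- `(Z,ρ)` is `(l₁,l₂)`-homogeneously dense. -/
def HomogeneouslyDense {Z : Type*} (ρ : Z → Z → ℝ) (l₁ l₂ : ℝ) : Prop :=
  ∀ a b : Z, a ≠ b → ∃ x : Z, l₁ * ρ a b ≤ ρ a x ∧ ρ a x ≤ l₂ * ρ a b

/-- The cross ratio `r(a,b,c,d) = ρ(a,c)ρ(b,d)/(ρ(a,b)ρ(c,d))`. -/
noncomputable def crossRatio {Z : Type*} (ρ : Z → Z → ℝ) (a b c d : Z) : ℝ :=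
  ρ a c * ρ b d / (ρ a b * ρ c d)

/-- `x : ℤ → Z` is a `σ`-chain joining `a` and `b`. -/
def IsSigmaChain {Z : Type*} (ρ : Z → Z → ℝ) (σ : ℝ) (a b : Z) (x : ℤ → Z) : Prop :=
  (∀ i : ℤ, a ≠ x i ∧ x i ≠ b) ∧
    Filter.Tendsto (fun i : ℤ => ρ (x i) a) Filter.atBot (nhds 0) ∧
    Filter.Tendsto (fun i : ℤ => ρ (x i) b) Filter.atTop (nhds 0) ∧
    ∀ i : ℤ, |Real.log (crossRatio ρ a (x i) (x (i + 1)) b)| ≤ Real.log σ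

/-- `(Z,ρ)` is `σ`-dense: any pair of distinct points is joined by a `σ`-chain. -/
def SigmaDense {Z : Type*} (ρ : Z → Z → ℝ) (σ : ℝ) : Prop :=
  ∀ a b : Z, a ≠ b → ∃ x : ℤ → Z, IsSigmaChain ρ σ a b x

/-- `η` is an increasing self-homeomorphism of `[0,∞)`. -/
def ControlFun (η : ℝ → ℝ) : Prop :=
  η 0 = 0 ∧ StrictMonoOn η (Set.Ici 0) ∧ ContinuousOn η (Set.Ici 0) ∧
    ∀ s : ℝ, 0 ≤ s → ∃ t : ℝ, 0 ≤ t ∧ η t = s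

/-- `f` is `η`-quasisymmetric. -/
def QuasiSymmetric {Z₁ Z₂ : Type*} (ρ₁ : Z₁ → Z₁ → ℝ) (ρ₂ : Z₂ → Z₂ → ℝ)
    (f : Z₁ → Z₂) (η : ℝ → ℝ) : Prop :=
  ∀ x a b : Z₁, x ≠ b → ∀ t : ℝ, 0 ≤ t → ρ₁ x a ≤ t * ρ₁ x b →
    ρ₂ (f x) (f a) ≤ η t * ρ₂ (f x) (f b)

/-- `f` is `θ`-quasimöbius. -/
def QuasiMobius {Z₁ Z₂ : Type*} (ρ₁ : Z₁ → Z₁ → ℝ) (ρ₂ : Z₂ → Z₂ → ℝ)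
    (f : Z₁ → Z₂) (θ : ℝ → ℝ) : Prop :=
  ∀ a b c d : Z₁, a ≠ b → a ≠ c → a ≠ d → b ≠ c → b ≠ d → c ≠ d →
    crossRatio ρ₂ (f a) (f b) (f c) (f d) ≤ θ (crossRatio ρ₁ a b c d)

/-- `(Z,ρ)` has no isolated points. -/
def NoIsolatedPoints {Z : Type*} (ρ : Z → Z → ℝ) : Prop :=
  ∀ x : Z, ∀ r : ℝ, 0 < r → ∃ y : Z, y ≠ x ∧ ρ x y < r

open Finset in
/-- Frink's chain inequality for a nonnegative gauge vanishing on the diagonal with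
`q(x,z) ≤ 2 max(q(x,y), q(y,z))`. -/
theorem frink_chain {X : Type*} (q : X → X → ℝ) (h0 : ∀ x y, 0 ≤ q x y)
    (hq : ∀ x y z, q x z ≤ 2 * max (q x y) (q y z)) (hself : ∀ x, q x x = 0) (x : ℕ → X)
    (k m : ℕ) :
    q (x m) (x (m + k + 2)) ≤
      4 * ∑ i ∈ range (k + 2), q (x (m + i)) (x (m + i + 1))
        - 2 * q (x m) (x (m + 1)) - 2 * q (x (m + k + 1)) (x (m + k + 2)) := by
  induction k using Nat.strong_induction_on generalizing m with
  | _ k ih =>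
    let e : ℕ → ℝ := fun i => q (x i) (x (i + 1))
    have he : ∀ i, 0 ≤ e i := fun i => h0 _ _
    change _ ≤ 4 * ∑ i ∈ range (k + 2), e (m + i) - 2 * e m - 2 * e (m + k + 1)
    have hmid : 0 ≤ ∑ i ∈ range k, e (m + (i + 1)) := sum_nonneg fun i _ => he _
    have hends : ∑ i ∈ range (k + 2), e (m + i)
        = ∑ i ∈ range k, e (m + (i + 1)) + e m + e (m + k + 1) := by
      rw [sum_range_succ, sum_range_succ']; rfl
    rcases (h0 (x m) (x (m + k + 2))).eq_or_lt with hz | hpos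
    · rw [← hz]
      linarith [he m, he (m + k + 1)]
    let P : ℕ → Prop := fun r => q (x m) (x (m + k + 2)) ≤ 2 * q (x (m + r)) (x (m + k + 2))
    have hP : ∃ r, r < k + 2 ∧ P r ∧ ¬ P (r + 1) := by
      by_contra! hcon
      have hall : ∀ r, r ≤ k + 2 → P r := by
        intro r
        induction r with
        | zero => intro _; change _ ≤ 2 * q (x m) _; linarith
        | succ r ihr => intro hr; exact hcon r (by omega) (ihr (by omega))
      have hlast : q (x m) (x (m + k + 2)) ≤ 2 * q (x (m + k + 2)) (x (m + k + 2)) :=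
        hall (k + 2) le_rfl
      rw [hself] at hlast
      linarith
    obtain ⟨r, hr, hr1, hr2⟩ := hP
    replace hr1 : q (x m) (x (m + k + 2)) ≤ 2 * q (x (m + r)) (x (m + k + 2)) := hr1
    replace hr2 : 2 * q (x (m + r + 1)) (x (m + k + 2)) < q (x m) (x (m + k + 2)) :=
      not_le.mp hr2
    have hr3 : q (x m) (x (m + k + 2)) ≤ 2 * q (x m) (x (m + r + 1)) := by
      have := hq (x m) (x (m + r + 1)) (x (m + k + 2))
      rcases max_cases (q (x m) (x (m + r + 1))) (q (x (m + r + 1)) (x (m + k + 2))) with h | h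
        <;> rw [h.1] at this <;> linarith
    rcases r with _ | s
    · change _ ≤ 2 * e m at hr3
      linarith [he (m + k + 1)]
    rcases (show s ≤ k by omega).eq_or_lt with rfl | hs
    · change _ ≤ 2 * e (m + s + 1) at hr1
      linarith [he m]
    obtain ⟨t, rfl⟩ : ∃ t, k = s + t + 1 := ⟨k - s - 1, by omega⟩
    have h1 : q (x m) (x (m + (s + 1) + 1))
        ≤ 4 * ∑ i ∈ range (s + 2), e (m + i) - 2 * e m - 2 * e (m + s + 1) := ih s (by omega) m
    have h2 := ih t (by omega) (m + s + 1)
    change _ ≤ 4 * ∑ i ∈ range (t + 2), e (m + s + 1 + i) - 2 * e (m + s + 1)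
      - 2 * e (m + s + 1 + t + 1) at h2
    have hsum : ∑ i ∈ range (s + t + 1 + 2), e (m + i)
        = ∑ i ∈ range (s + 1), e (m + i) + ∑ i ∈ range (t + 2), e (m + s + 1 + i) := by
      rw [show s + t + 1 + 2 = (s + 1) + (t + 2) by ring, sum_range_add]
      simp only [add_assoc]
    rw [sum_range_succ] at h1
    rw [hsum]
    have i1 : m + s + 1 + t + 2 = m + (s + t + 1) + 2 := by ring
    have i2 : m + s + 1 + t + 1 = m + (s + t + 1) + 1 := by ring
    have i3 : m + (s + 1) = m + s + 1 := by ring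
    rw [i1, i2] at h2
    rw [i3] at hr1 hr3 h1
    linarith

/-- Every list chain from `a` to `b` is traversed by a sequence with the same total length. -/
theorem exists_seq_of_list {X M : Type*} [AddCommMonoid M] (q : X → X → M) (l : List X)
    (a b : X) :
    ∃ x : ℕ → X, x 0 = a ∧ x (l.length + 1) = b ∧
      (List.zipWith q (a :: l) (l ++ [b])).sum
        = ∑ i ∈ Finset.range (l.length + 1), q (x i) (x (i + 1)) := by
  induction l generalizing a with
  | nil => exact ⟨fun n => if n = 0 then a else b, by simp⟩
  | cons c l ih =>
    obtain ⟨x, hx0, hx1, hx⟩ := ih c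
    refine ⟨fun n => Nat.casesOn n a x, rfl, hx1, ?_⟩
    rw [List.cons_append, List.zipWith_cons_cons, List.sum_cons, hx, List.length_cons,
      Finset.sum_range_succ' _ (l.length + 1), add_comm]
    simp [hx0]

/-- The total length of a chain bounds a quarter of the gauge between its endpoints. -/
theorem le_four_mul_sum_chain {X : Type*} (q : X → X → ℝ) (h0 : ∀ x y, 0 ≤ q x y)
    (hq : ∀ x y z, q x z ≤ 2 * max (q x y) (q y z)) (hself : ∀ x, q x x = 0) (x : ℕ → X)
    (n : ℕ) :
    q (x 0) (x (n + 1)) ≤ 4 * ∑ i ∈ Finset.range (n + 1), q (x i) (x (i + 1)) := by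
  rcases n with _ | n
  · simp only [zero_add, Finset.sum_range_one]
    linarith [h0 (x 0) (x 1)]
  · have h := frink_chain q h0 hq hself x n 0
    simp only [zero_add] at h
    linarith [h0 (x 0) (x 1), h0 (x (n + 1)) (x (n + 2))]

/-- A gauge with `q(x,z) ≤ 2 max(q(x,y), q(y,z))` is comparable to a metric. -/
theorem exists_metric_of_two_mul_max {X : Type*} (q : X → X → ℝ) (hq : IsQuasiMetric 2 q) :
    ∃ d : X → X → ℝ,
      (∀ x y : X, 0 ≤ d x y) ∧ (∀ x y : X, d x y = 0 ↔ x = y) ∧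
      (∀ x y : X, d x y = d y x) ∧ (∀ x y z : X, d x z ≤ d x y + d y z) ∧
      ∀ x y : X, (1 / 4) * q x y ≤ d x y ∧ d x y ≤ q x y := by
  obtain ⟨h0, heq, hsymm, hmax⟩ := hq
  let p : X → X → NNReal := fun x y => ⟨q x y, h0 x y⟩
  have hp0 : ∀ x, p x x = 0 := fun x => NNReal.eq ((heq x x).2 rfl)
  have hps : ∀ x y, p x y = p y x := fun x y => NNReal.eq (hsymm x y)
  let _ : PseudoMetricSpace X := PseudoMetricSpace.ofPreNNDist p hp0 hps
  have hle : ∀ x y : X, dist x y ≤ q x y := PseudoMetricSpace.dist_ofPreNNDist_le p hp0 hps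
  have hge : ∀ a b : X, (1 / 4) * q a b ≤ dist a b := by
    intro a b
    have hd := PseudoMetricSpace.dist_ofPreNNDist p hp0 hps a b
    refine le_of_le_of_eq ?_ hd.symm
    rw [NNReal.coe_iInf]
    refine le_ciInf fun l => ?_
    obtain ⟨x, rfl, rfl, hx⟩ := exists_seq_of_list p l a b
    rw [hx, NNReal.coe_sum]
    have h := le_four_mul_sum_chain q h0 hmax (fun x => (heq x x).2 rfl) x l.length
    change _ ≤ ∑ i ∈ Finset.range (l.length + 1), q (x i) (x (i + 1))
    linarith
  refine ⟨dist, fun _ _ => dist_nonneg, fun x y => ⟨fun h => ?_, ?_⟩, dist_comm,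
    dist_triangle, fun x y => ⟨hge x y, hle x y⟩⟩
  · exact (heq x y).1 (le_antisymm (by linarith [hge x y]) (h0 x y))
  · rintro rfl
    exact dist_self x

/-- Raising a `K`-quasi-metric to the power `ε` gives a `K'`-quasi-metric if `K ^ ε ≤ K'`. -/
theorem IsQuasiMetric.rpow {X : Type*} {K K' ε : ℝ} {ρ : X → X → ℝ} (hρ : IsQuasiMetric K ρ)
    (hK : 0 ≤ K) (hε : 0 < ε) (hKε : K ^ ε ≤ K') :
    IsQuasiMetric K' fun x y => ρ x y ^ ε := by
  obtain ⟨h0, heq, hsymm, hmax⟩ := hρ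
  refine ⟨fun x y => Real.rpow_nonneg (h0 x y) ε, fun x y => ?_, fun x y => ?_,
    fun x y z => ?_⟩
  · rw [Real.rpow_eq_zero (h0 x y) hε.ne', heq]
  · simp only [hsymm x y]
  · have hm : max (ρ x y) (ρ y z) ^ ε ≤ max (ρ x y ^ ε) (ρ y z ^ ε) := by
      rcases max_choice (ρ x y) (ρ y z) with h | h <;> simp [h]
    calc ρ x z ^ ε ≤ (K * max (ρ x y) (ρ y z)) ^ ε :=
          Real.rpow_le_rpow (h0 x z) (hmax x y z) hε.le
      _ = K ^ ε * max (ρ x y) (ρ y z) ^ ε :=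
          Real.mul_rpow hK (le_max_of_le_left (h0 x y))
      _ ≤ K' * max (ρ x y ^ ε) (ρ y z ^ ε) :=
          mul_le_mul hKε hm (Real.rpow_nonneg (le_max_of_le_left (h0 x y)) ε)
            ((Real.rpow_nonneg hK ε).trans hKε)

/-- A `K`-quasi-metric `ρ` with `K^ε ≤ 2` (`0 < ε ≤ 1`) admits a metric `d`
with `(1/4)·ρ^ε ≤ d ≤ ρ^ε`. -/
theorem stmt0 {X : Type u} (K : ℝ) (hK : 1 ≤ K) (ρ : X → X → ℝ)
    (hρ : IsQuasiMetric K ρ) (ε : ℝ) (hε0 : 0 < ε) (hε1 : ε ≤ 1) (hKε : K ^ ε ≤ 2) :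
    ∃ d : X → X → ℝ,
      (∀ x y : X, 0 ≤ d x y) ∧ (∀ x y : X, d x y = 0 ↔ x = y) ∧
      (∀ x y : X, d x y = d y x) ∧ (∀ x y z : X, d x z ≤ d x y + d y z) ∧
      ∀ z₁ z₂ : X, (1 / 4) * ρ z₁ z₂ ^ ε ≤ d z₁ z₂ ∧ d z₁ z₂ ≤ ρ z₁ z₂ ^ ε := by
  exact exists_metric_of_two_mul_max _ (hρ.rpow (zero_le_one.trans hK) hε0 hKε)
end

section
/- If a K-quasi-metric space (Z,ρ) is (λ₁,λ₂)-HD, then (Z,ρ) is μ-uniformly perfect for a constant μ ∈ (0,1) depending only on λ₁, λ₂ and K. -/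
open Filter Topology

universe u v

/-- A `(l₁,l₂)`-homogeneously dense function that vanishes on the diagonal is `l₁`-uniformly
perfect: iterating the density condition at a base point shrinks distances to it by a factor in
`[l₁, l₂]`, so the first one below `r` is at least `l₁ * r`. -/
theorem HomogeneouslyDense.uniformlyPerfectWith {Z : Type*} {ρ : Z → Z → ℝ} {l₁ l₂ : ℝ}
    (hρ : ∀ x, ρ x x = 0) (hl1 : 0 ≤ l₁) (hl2_nonneg : 0 ≤ l₂) (hl2 : l₂ < 1)
    (h : HomogeneouslyDense ρ l₁ l₂) : UniformlyPerfectWith ρ l₁ := by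
  rintro x r hr ⟨z, hz⟩
  by_contra! hgap
  have hiter : ∀ n : ℕ, ∃ y, r ≤ ρ x y ∧ ρ x y ≤ l₂ ^ n * ρ x z := by
    intro n
    induction n with
    | zero => exact ⟨z, hz, by simp⟩
    | succ n ih =>
      obtain ⟨y, hry, hy⟩ := ih
      have hxy : x ≠ y := fun e => (hr.trans_le hry).ne' (e ▸ hρ x)
      obtain ⟨w, hw₁, hw₂⟩ := h x y hxy
      refine ⟨w, hgap w ((mul_le_mul_of_nonneg_left hry hl1).trans hw₁), hw₂.trans ?_⟩
      calc l₂ * ρ x y ≤ l₂ * (l₂ ^ n * ρ x z) := mul_le_mul_of_nonneg_left hy hl2_nonneg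
        _ = l₂ ^ (n + 1) * ρ x z := by ring
  have hz_pos : 0 < ρ x z := hr.trans_le hz
  obtain ⟨n, hn⟩ := exists_pow_lt_of_lt_one (div_pos hr hz_pos) hl2
  obtain ⟨y, hry, hy⟩ := hiter n
  exact (hry.trans hy).not_gt ((lt_div_iff₀ hz_pos).1 hn)

/-- homogeneous density implies uniform perfectness, quantitatively. -/
theorem stmt2 (K l₁ l₂ : ℝ) (hK : 1 ≤ K) (hl1 : 0 < l₁) (hl12 : l₁ ≤ l₂) (hl2 : l₂ < 1) :
    ∃ μ : ℝ, 0 < μ ∧ μ < 1 ∧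
      ∀ {Z : Type u} (ρ : Z → Z → ℝ), IsQuasiMetric K ρ →
        HomogeneouslyDense ρ l₁ l₂ → UniformlyPerfectWith ρ μ := by
  exact ⟨l₁, hl1, hl12.trans_lt hl2, fun ρ hρ h =>
    h.uniformlyPerfectWith (fun x => (hρ.2.1 x x).2 rfl) hl1.le (hl1.le.trans hl12) hl2⟩
end

section
/- If a K-quasi-metric space (Z,ρ) is (λ₁,λ₂)-HD, then (Z,ρ) is σ-dense for a constant σ > 1 depending only on λ₁, λ₂ and K. -/
open Filter Topology

universe u v

theorem abs_log_div_le_of_comparable {C p q s t : ℝ} (hp : 0 < p) (hq : 0 < q) (hs : 0 < s)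
    (ht : 0 < t) (hC : 0 < C) (hps : p ≤ C * s) (hsp : s ≤ C * p) (hqt : q ≤ C * t)
    (htq : t ≤ C * q) : |Real.log (p * q / (s * t))| ≤ Real.log (C ^ 2) := by
  have hst : 0 < s * t := mul_pos hs ht
  have hpq : 0 < p * q := mul_pos hp hq
  rw [abs_le, neg_le, ← Real.log_inv, inv_div]
  constructor
  · refine Real.log_le_log (div_pos hst hpq) ?_
    rw [div_le_iff₀ hpq]
    calc s * t ≤ (C * p) * (C * q) := by gcongr
      _ = C ^ 2 * (p * q) := by ring
  · refine Real.log_le_log (div_pos hpq hst) ?_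
    rw [div_le_iff₀ hst]
    calc p * q ≤ (C * s) * (C * t) := by gcongr
      _ = C ^ 2 * (s * t) := by ring

theorem IsQuasiMetric.pos {Z : Type*} {K : ℝ} {ρ : Z → Z → ℝ} (h : IsQuasiMetric K ρ) {x y : Z}
    (hxy : x ≠ y) : 0 < ρ x y :=
  lt_of_le_of_ne (h.1 x y) fun h0 => hxy ((h.2.1 x y).1 h0.symm)

theorem crossRatio_reverse {Z : Type*} {K : ℝ} {ρ : Z → Z → ℝ} (h : IsQuasiMetric K ρ)
    (a b c d : Z) : crossRatio ρ a b c d = crossRatio ρ d c b a := by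
  obtain ⟨-, -, hsymm, -⟩ := h
  unfold crossRatio
  rw [hsymm d b, hsymm c a, hsymm d c, hsymm b a, mul_comm (ρ a c), mul_comm (ρ a b)]

/-- Iterating homogeneous density at `a`, starting from `b`. -/
theorem HomogeneouslyDense.exists_geometric_seq {Z : Type*} {ρ : Z → Z → ℝ} {K l₁ l₂ : ℝ}
    (hd : HomogeneouslyDense ρ l₁ l₂) (hρ : IsQuasiMetric K ρ) (hl1 : 0 < l₁)
    {a b : Z} (hab : a ≠ b) :
    ∃ w : ℕ → Z, w 0 = b ∧ ∀ n, a ≠ w n ∧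
      l₁ * ρ a (w n) ≤ ρ a (w (n + 1)) ∧ ρ a (w (n + 1)) ≤ l₂ * ρ a (w n) := by
  have hex : ∀ x : Z, ∃ y, a ≠ x → l₁ * ρ a x ≤ ρ a y ∧ ρ a y ≤ l₂ * ρ a x := fun x => by
    by_cases hx : a = x
    · exact ⟨x, fun h => absurd hx h⟩
    · obtain ⟨y, hy⟩ := hd a x hx
      exact ⟨y, fun _ => hy⟩
  choose f hf using hex
  have hne : ∀ n, a ≠ f^[n] b := by
    intro n
    induction n with
    | zero => exact hab
    | succ n ih =>
      rw [Function.iterate_succ_apply']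
      intro h
      have h0 : ρ a (f (f^[n] b)) = 0 := (hρ.2.1 _ _).2 h
      linarith [(hf _ ih).1, mul_pos hl1 (hρ.pos ih)]
  refine ⟨fun n => f^[n] b, rfl, fun n => ⟨hne n, ?_⟩⟩
  simpa only [Function.iterate_succ_apply'] using hf _ (hne n)

theorem HomogeneouslyDense.exists_half_chain {Z : Type*} {ρ : Z → Z → ℝ} {K l₁ l₂ : ℝ}
    (hd : HomogeneouslyDense ρ l₁ l₂) (hρ : IsQuasiMetric K ρ) (hK : 1 ≤ K) (hl1 : 0 < l₁)
    (hl12 : l₁ ≤ l₂) (hl2 : l₂ < 1) {N : ℕ} (hN : K * l₂ ^ N < 1) {a b : Z} (hab : a ≠ b) :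
    ∃ y : ℕ → Z, Tendsto (fun n => ρ a (y n)) atTop (𝓝 0) ∧
      l₁ ^ N * ρ a b ≤ ρ a (y 0) ∧ ρ a (y 0) ≤ ρ a b ∧ ∀ n, a ≠ y n ∧ y n ≠ b ∧
        l₁ * ρ a (y n) ≤ ρ a (y (n + 1)) ∧ ρ a (y (n + 1)) ≤ ρ a (y n) ∧
        ρ a b ≤ K * ρ (y n) b ∧ ρ (y n) b ≤ K * ρ a b := by
  obtain ⟨w, hw0, hw⟩ := hd.exists_geometric_seq hρ hl1 hab
  have hl2' : 0 < l₂ := hl1.trans_le hl12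
  have hD := hρ.pos hab
  have hup : ∀ n, ρ a (w n) ≤ l₂ ^ n * ρ a b := by
    intro n
    induction n with
    | zero => simp [hw0]
    | succ n ih =>
      calc ρ a (w (n + 1)) ≤ l₂ * ρ a (w n) := (hw n).2.2
        _ ≤ l₂ * (l₂ ^ n * ρ a b) := by gcongr
        _ = l₂ ^ (n + 1) * ρ a b := by ring
  have hlow : ∀ n, l₁ ^ n * ρ a b ≤ ρ a (w n) := by
    intro n
    induction n with
    | zero => simp [hw0]
    | succ n ih =>
      calc l₁ ^ (n + 1) * ρ a b = l₁ * (l₁ ^ n * ρ a b) := by ring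
        _ ≤ l₁ * ρ a (w n) := by gcongr
        _ ≤ ρ a (w (n + 1)) := (hw n).2.1
  have hle : ∀ n, ρ a (w n) ≤ ρ a b := fun n =>
    (hup n).trans (mul_le_of_le_one_left hD.le (pow_le_one₀ hl2'.le hl2.le))
  have hfar : ∀ n, ρ a b ≤ K * ρ (w (n + N)) b := by
    intro n
    have hclose : K * ρ a (w (n + N)) < ρ a b := by
      calc K * ρ a (w (n + N)) ≤ K * (l₂ ^ (n + N) * ρ a b) := by
            gcongr; exact hup _
        _ ≤ K * (l₂ ^ N * ρ a b) := by
            have : l₂ ^ (n + N) ≤ l₂ ^ N :=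
              pow_le_pow_of_le_one hl2'.le hl2.le (Nat.le_add_left N n)
            gcongr
        _ = (K * l₂ ^ N) * ρ a b := by ring
        _ < ρ a b := mul_lt_of_lt_one_left hD hN
    have htri := hρ.2.2.2 a (w (n + N)) b
    rcases max_choice (ρ a (w (n + N))) (ρ (w (n + N)) b) with h | h <;> rw [h] at htri <;>
      linarith
  refine ⟨fun n => w (n + N), ?_, by simpa using hlow N, by simpa using hle N, fun n => ?_⟩
  · have hlim : Tendsto (fun n => l₂ ^ n * ρ a b) atTop (𝓝 0) := by
      simpa using (tendsto_pow_atTop_nhds_zero_of_lt_one hl2'.le hl2).mul_const (ρ a b)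
    exact (squeeze_zero (fun n => hρ.1 _ _) hup hlim).comp (tendsto_add_atTop_nat N)
  · dsimp only
    have hpos := hρ.pos (hw (n + N)).1
    have hidx : n + 1 + N = n + N + 1 := by ring
    rw [hidx]
    refine ⟨(hw _).1, ?_, (hw _).2.1, ?_, hfar n, ?_⟩
    · intro h
      have h0 := (hρ.2.1 _ _).2 h
      have := hfar n
      rw [h0] at this
      linarith
    · exact (hw _).2.2.trans (mul_le_of_le_one_left hpos.le hl2.le)
    · refine (hρ.2.2.2 _ a _).trans ?_
      rw [hρ.2.2.1 (w (n + N)) a, max_eq_right (hle _)]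

/-- homogeneous density implies `σ`-density, quantitatively. -/
theorem stmt3 (K l₁ l₂ : ℝ) (hK : 1 ≤ K) (hl1 : 0 < l₁) (hl12 : l₁ ≤ l₂) (hl2 : l₂ < 1) :
    ∃ σ : ℝ, 1 < σ ∧
      ∀ {Z : Type u} (ρ : Z → Z → ℝ), IsQuasiMetric K ρ →
        HomogeneouslyDense ρ l₁ l₂ → SigmaDense ρ σ := by
  have hK0 : 0 < K := zero_lt_one.trans_le hK
  have hl1' : l₁ < 1 := hl12.trans_lt hl2
  obtain ⟨N, hN⟩ : ∃ N : ℕ, K * l₂ ^ N < 1 := by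
    obtain ⟨N, hN⟩ := exists_pow_lt_of_lt_one (inv_pos.2 hK0) hl2
    refine ⟨N, ?_⟩
    calc K * l₂ ^ N < K * K⁻¹ := by gcongr
      _ = 1 := mul_inv_cancel₀ hK0.ne'
  have hpow : 0 < l₁ ^ (N + 1) := pow_pos hl1 _
  obtain ⟨C, hC⟩ : ∃ C, C = K ^ 2 / l₁ ^ (N + 1) := ⟨_, rfl⟩
  have hK2 : 1 ≤ K ^ 2 := one_le_pow₀ hK
  have hCK2 : K ^ 2 ≤ C := by
    rw [hC, le_div_iff₀ hpow]
    exact mul_le_of_le_one_right (by positivity) (pow_le_one₀ hl1.le hl1'.le)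
  have hC1 : 1 < C := by
    rw [hC, one_lt_div hpow]
    exact (pow_lt_one₀ hl1.le hl1' N.succ_ne_zero).trans_le hK2
  have hKC : K ≤ C := (le_self_pow₀ hK two_ne_zero).trans hCK2
  have hCl : 1 ≤ C * l₁ := by
    rw [hC, div_mul_eq_mul_div, le_div_iff₀ hpow, one_mul, pow_succ]
    gcongr
    exact (pow_le_one₀ hl1.le hl1'.le).trans hK2
  have hClN : K ≤ C * l₁ ^ N := by
    rw [hC, div_mul_eq_mul_div, le_div_iff₀ hpow, pow_succ]
    have hKK : K * l₁ ≤ K ^ 2 := by nlinarith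
    calc K * (l₁ ^ N * l₁) = (K * l₁) * l₁ ^ N := by ring
      _ ≤ K ^ 2 * l₁ ^ N := by gcongr
  have hC0 : 0 < C := zero_lt_one.trans hC1
  refine ⟨C ^ 2, one_lt_pow₀ hC1 two_ne_zero, fun {Z} ρ hρ hd a b hab => ?_⟩
  have hstep : ∀ {a b : Z}, a ≠ b → ∀ {y : ℕ → Z}, (∀ n, a ≠ y n ∧ y n ≠ b ∧
        l₁ * ρ a (y n) ≤ ρ a (y (n + 1)) ∧ ρ a (y (n + 1)) ≤ ρ a (y n) ∧
        ρ a b ≤ K * ρ (y n) b ∧ ρ (y n) b ≤ K * ρ a b) →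
      ∀ n, |Real.log (crossRatio ρ a (y (n + 1)) (y n) b)| ≤ Real.log (C ^ 2) := by
    intro a b hab y hy n
    have hcomp : ∀ m k, ρ (y m) b ≤ C * ρ (y k) b := fun m k => by
      calc ρ (y m) b ≤ K * (K * ρ (y k) b) :=
            (hy m).2.2.2.2.2.trans (by gcongr; exact (hy k).2.2.2.2.1)
        _ = K ^ 2 * ρ (y k) b := by ring
        _ ≤ C * ρ (y k) b := by gcongr; exact hρ.1 _ _
    have hn := hρ.pos (hy n).1
    have hn' := hρ.pos (hy (n + 1)).1
    refine abs_log_div_le_of_comparable hn (hρ.pos (hy (n + 1)).2.1) hn'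
      (hρ.pos (hy n).2.1) hC0 ?_ ?_ (hcomp _ _) (hcomp _ _)
    · calc ρ a (y n) ≤ (C * l₁) * ρ a (y n) := le_mul_of_one_le_left hn.le hCl
        _ = C * (l₁ * ρ a (y n)) := by ring
        _ ≤ C * ρ a (y (n + 1)) := by gcongr; exact (hy n).2.2.1
    · exact (hy n).2.2.2.1.trans (le_mul_of_one_le_left hn.le hC1.le)
  have hjoin : ∀ {D p s : ℝ}, 0 < D → l₁ ^ N * D ≤ s → s ≤ D → D ≤ K * p → p ≤ K * D →
      p ≤ C * s ∧ s ≤ C * p := by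
    intro D p s hD hs hs' hp hp'
    constructor
    · calc p ≤ K * D := hp'
        _ ≤ (C * l₁ ^ N) * D := by gcongr
        _ = C * (l₁ ^ N * D) := by ring
        _ ≤ C * s := by gcongr
    · have hp0 : 0 ≤ p := (pos_of_mul_pos_right (hD.trans_le hp) hK0.le).le
      exact (hs'.trans hp).trans (by gcongr)
  obtain ⟨y, hylim, hy0, hy0', hy⟩ := hd.exists_half_chain hρ hK hl1 hl12 hl2 hN hab
  obtain ⟨z, hzlim, hz0, hz0', hz⟩ := hd.exists_half_chain hρ hK hl1 hl12 hl2 hN hab.symm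
  have hsymm := hρ.2.2.1
  let x : ℤ → Z
    | Int.ofNat n => z n
    | Int.negSucc n => y n
  refine ⟨x, ?_, ?_, ?_, ?_⟩
  · rintro (n | n)
    · exact ⟨(hz n).2.1.symm, (hz n).1.symm⟩
    · exact ⟨(hy n).1, (hy n).2.1⟩
  · rw [Metric.tendsto_nhds] at hylim ⊢
    intro ε hε
    obtain ⟨M, hM⟩ := eventually_atTop.1 (hylim ε hε)
    refine eventually_atBot.2 ⟨Int.negSucc M, ?_⟩
    rintro (n | n) hn
    · exact absurd hn (by simp only [Int.ofNat_eq_natCast]; omega)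
    · rw [hsymm]
      exact hM n (by omega)
  · rw [Metric.tendsto_nhds] at hzlim ⊢
    intro ε hε
    obtain ⟨M, hM⟩ := eventually_atTop.1 (hzlim ε hε)
    refine eventually_atTop.2 ⟨Int.ofNat M, ?_⟩
    rintro (n | n) hn
    · rw [hsymm]
      exact hM n (by simp only [Int.ofNat_eq_natCast] at hn; omega)
    · exact absurd hn (by simp only [Int.ofNat_eq_natCast]; omega)
  · rintro (n | _ | n)
    · rw [crossRatio_reverse hρ]
      exact hstep hab.symm hz n
    · change |Real.log (crossRatio ρ a (y 0) (z 0) b)| ≤ _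
      have hzp := (hz 0).2.2.2.2
      rw [hsymm (z 0) a, hsymm b a] at hzp
      have hyp := (hy 0).2.2.2.2
      rw [hsymm b a, hsymm b (z 0)] at hz0 hz0'
      have hD := hρ.pos hab
      obtain ⟨h1, h2⟩ := hjoin hD hy0 hy0' hzp.1 hzp.2
      obtain ⟨h3, h4⟩ := hjoin hD hz0 hz0' hyp.1 hyp.2
      exact abs_log_div_le_of_comparable (hρ.pos (hz 0).2.1.symm) (hρ.pos (hy 0).2.1)
        (hρ.pos (hy 0).1) (hρ.pos (hz 0).1.symm) hC0 h1 h2 h3 h4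
    · exact hstep hab hy n
end

section
/- Let (Z,ρ) be a K-quasi-metric space containing at least three points, and suppose there are numbers 0 < μ₁ ≤ μ₂ < 1 such that for every triple (a,c,d) of pairwise distinct points in Z there is a point x ∈ Z, distinct from a and d, satisfying μ₁ ≤ r(a,x,c,d) ≤ μ₂. Then (Z,ρ) is (1/μ₁)-dense. -/
open Filter Topology

universe u v

lemma crossRatio_swap_middle {Z : Type u} (ρ : Z → Z → ℝ) (a b c d : Z) :
    crossRatio ρ a c b d = (crossRatio ρ a b c d)⁻¹ := by
  simp only [crossRatio, inv_div]

namespace IsQuasiMetric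

variable {Z : Type u} {K : ℝ} {ρ : Z → Z → ℝ}

lemma pos_s5 (hρ : IsQuasiMetric K ρ) {x y : Z} (hxy : x ≠ y) : 0 < ρ x y :=
  lt_of_le_of_ne (hρ.1 x y) fun h => hxy ((hρ.2.1 x y).1 h.symm)

/-- If `ρ p b / ρ a p` is small, then `p` is close to `b`. -/
lemma le_of_ratio_lt (hρ : IsQuasiMetric K ρ) {a b p : Z} (hpa : p ≠ a) (hpb : p ≠ b)
    (hsmall : ρ p b / ρ a p * K < 1) :
    ρ p b ≤ ρ p b / ρ a p * (K * ρ a b) := by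
  have hap : 0 < ρ a p := hρ.pos_s5 hpa.symm
  have hb : 0 < ρ p b := hρ.pos_s5 hpb
  have hratio : 0 < ρ p b / ρ a p := div_pos hb hap
  have heq : ρ p b / ρ a p * ρ a p = ρ p b := div_mul_cancel₀ _ hap.ne'
  have htri := hρ.2.2.2 a b p
  rw [hρ.2.2.1 b p] at htri
  rcases le_total (ρ p b) (ρ a b) with hle | hle
  · rw [max_eq_left hle] at htri
    linarith [mul_le_mul_of_nonneg_left htri hratio.le]
  · rw [max_eq_right hle] at htri
    nlinarith [mul_le_mul_of_nonneg_left htri hratio.le]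

lemma tendsto_of_ratio (hρ : IsQuasiMetric K ρ) {a b : Z} {y : ℕ → Z}
    (hya : ∀ n, y n ≠ a) (hyb : ∀ n, y n ≠ b)
    (hy : Tendsto (fun n => ρ (y n) b / ρ a (y n)) atTop (𝓝 0)) :
    Tendsto (fun n => ρ (y n) b) atTop (𝓝 0) := by
  have hK : Tendsto (fun n => ρ (y n) b / ρ a (y n) * K) atTop (𝓝 0) := by
    simpa using hy.mul_const K
  have hbound : Tendsto (fun n => ρ (y n) b / ρ a (y n) * (K * ρ a b)) atTop (𝓝 0) := by
    simpa using hy.mul_const (K * ρ a b)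
  refine squeeze_zero' (.of_forall fun n => hρ.1 _ _) ?_ hbound
  filter_upwards [hK.eventually_lt_const one_pos] with n hn
  exact hρ.le_of_ratio_lt (hya n) (hyb n) hn

lemma tendsto_of_crossRatio_le (hρ : IsQuasiMetric K ρ) {a b : Z} {y : ℕ → Z} {μ : ℝ}
    (hya : ∀ n, y n ≠ a) (hyb : ∀ n, y n ≠ b) (hμ₀ : 0 ≤ μ) (hμ : μ < 1)
    (hy : ∀ n, crossRatio ρ a (y (n + 1)) (y n) b ≤ μ) :
    Tendsto (fun n => ρ (y n) b) atTop (𝓝 0) := by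
  apply hρ.tendsto_of_ratio hya hyb
  have hstep : ∀ n, ρ (y (n + 1)) b / ρ a (y (n + 1)) ≤ μ * (ρ (y n) b / ρ a (y n)) := by
    intro n
    have h₁ := hρ.pos_s5 (hya n).symm
    have h₂ := hρ.pos_s5 (hyb n)
    rw [← div_le_iff₀ (div_pos h₂ h₁), div_div_div_eq, mul_comm (ρ (y (n + 1)) b)]
    exact hy n
  have hpow : ∀ n, ρ (y n) b / ρ a (y n) ≤ μ ^ n * (ρ (y 0) b / ρ a (y 0)) := by
    intro n
    induction n with
    | zero => simp
    | succ n ih =>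
      calc _ ≤ _ := hstep n
        _ ≤ μ * (μ ^ n * (ρ (y 0) b / ρ a (y 0))) := mul_le_mul_of_nonneg_left ih hμ₀
        _ = _ := by ring
  refine squeeze_zero (fun n => div_nonneg (hρ.1 _ _) (hρ.1 _ _)) hpow ?_
  simpa using (tendsto_pow_atTop_nhds_zero_of_lt_one hμ₀ hμ).mul_const (ρ (y 0) b / ρ a (y 0))

/-- Iterating the density hypothesis from `c` gives a sequence converging to `b`. -/
lemma exists_half_chain (hρ : IsQuasiMetric K ρ) {μ₁ μ₂ : ℝ} (hμ₀ : 0 ≤ μ₂) (hμ : μ₂ < 1)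
    (h : ∀ a c d : Z, a ≠ c → a ≠ d → c ≠ d →
      ∃ x : Z, x ≠ a ∧ x ≠ d ∧ μ₁ ≤ crossRatio ρ a x c d ∧ crossRatio ρ a x c d ≤ μ₂)
    {a b c : Z} (hab : a ≠ b) (hca : c ≠ a) (hcb : c ≠ b) :
    ∃ y : ℕ → Z, y 0 = c ∧ (∀ n, y n ≠ a) ∧ (∀ n, y n ≠ b) ∧
      (∀ n, μ₁ ≤ crossRatio ρ a (y (n + 1)) (y n) b ∧
        crossRatio ρ a (y (n + 1)) (y n) b ≤ μ₂) ∧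
      Tendsto (fun n => ρ (y n) b) atTop (𝓝 0) := by
  have hnext (p : {p : Z // p ≠ a ∧ p ≠ b}) : ∃ q : {q : Z // q ≠ a ∧ q ≠ b},
      μ₁ ≤ crossRatio ρ a q p b ∧ crossRatio ρ a q p b ≤ μ₂ := by
    obtain ⟨x, hxa, hxb, hx⟩ := h a p b p.2.1.symm hab p.2.2
    exact ⟨⟨x, hxa, hxb⟩, hx⟩
  choose next hnext using hnext
  let y : ℕ → {p : Z // p ≠ a ∧ p ≠ b} := fun n => next^[n] ⟨c, hca, hcb⟩
  have hy (n : ℕ) : μ₁ ≤ crossRatio ρ a (y (n + 1)) (y n) b ∧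
      crossRatio ρ a (y (n + 1)) (y n) b ≤ μ₂ := by
    simp only [y, Function.iterate_succ_apply']
    exact hnext _
  exact ⟨fun n => y n, rfl, fun n => (y n).2.1, fun n => (y n).2.2, hy,
    hρ.tendsto_of_crossRatio_le (fun n => (y n).2.1) (fun n => (y n).2.2) hμ₀ hμ
      fun n => (hy n).2⟩

lemma crossRatio_swap_ends (hρ : IsQuasiMetric K ρ) (a b c d : Z) :
    crossRatio ρ d b c a = (crossRatio ρ a b c d)⁻¹ := by
  simp only [crossRatio, inv_div, hρ.2.2.1 d, hρ.2.2.1 a]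
  ring

end IsQuasiMetric

lemma abs_log_inv_le_log_one_div {μ t : ℝ} (hμ : 0 < μ) (hμt : μ ≤ t) (ht : t ≤ 1) :
    |Real.log t⁻¹| ≤ Real.log (1 / μ) := by
  rw [Real.log_inv, abs_neg, abs_of_nonpos (Real.log_nonpos (hμ.le.trans hμt) ht), one_div,
    Real.log_inv]
  exact neg_le_neg (Real.log_le_log hμ hμt)

/-- if every triple `(a,c,d)` admits `x` with `μ₁ ≤ r(a,x,c,d) ≤ μ₂`,
then the space is `(1/μ₁)`-dense. -/
theorem stmt5 {Z : Type u} (K : ℝ) (hK : 1 ≤ K) (ρ : Z → Z → ℝ)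
    (hρ : IsQuasiMetric K ρ)
    (hcard : ∃ x y z : Z, x ≠ y ∧ y ≠ z ∧ x ≠ z)
    (μ₁ μ₂ : ℝ) (h1 : 0 < μ₁) (h12 : μ₁ ≤ μ₂) (h2 : μ₂ < 1)
    (h : ∀ a c d : Z, a ≠ c → a ≠ d → c ≠ d →
      ∃ x : Z, x ≠ a ∧ x ≠ d ∧ μ₁ ≤ crossRatio ρ a x c d ∧ crossRatio ρ a x c d ≤ μ₂) :
    SigmaDense ρ (1 / μ₁) := by
  intro a b hab
  obtain ⟨c, hca, hcb⟩ : ∃ c, c ≠ a ∧ c ≠ b := by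
    obtain ⟨p, q, r, hpq, hqr, hpr⟩ := hcard
    by_contra! hall
    by_cases hp : p = a
    · exact hqr ((hall q fun hq => hpq (hp.trans hq.symm)).trans
        (hall r fun hr => hpr (hp.trans hr.symm)).symm)
    · have hq : q = a := not_ne_iff.1 fun hq => hpq ((hall p hp).trans (hall q hq).symm)
      have hr : r = a := not_ne_iff.1 fun hr => hpr ((hall p hp).trans (hall r hr).symm)
      exact hqr (hq.trans hr.symm)
  have hμ₀ : 0 ≤ μ₂ := h1.le.trans h12
  obtain ⟨y, hy0, hya, hyb, hy, hylim⟩ := hρ.exists_half_chain hμ₀ h2 h hab hca hcb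
  obtain ⟨z, hz0, hzb, hza, hz, hzlim⟩ := hρ.exists_half_chain hμ₀ h2 h hab.symm hcb hca
  refine ⟨fun i => if 0 ≤ i then y i.toNat else z (-i).toNat, fun i => ?_, ?_, ?_, fun i => ?_⟩
  · dsimp only
    split_ifs
    · exact ⟨(hya _).symm, hyb _⟩
    · exact ⟨(hza _).symm, hzb _⟩
  · have hneg : Tendsto (fun i : ℤ => (-i).toNat) atBot atTop :=
      tendsto_atTop.2 fun n => by
        filter_upwards [eventually_le_atBot (-(n : ℤ))] with i hi
        omega
    refine (hzlim.comp hneg).congr' ?_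
    filter_upwards [eventually_lt_atBot (0 : ℤ)] with i hi
    simp [not_le.2 hi]
  · have hnat : Tendsto (fun i : ℤ => i.toNat) atTop atTop :=
      tendsto_atTop.2 fun n => by
        filter_upwards [eventually_ge_atTop (n : ℤ)] with i hi
        omega
    refine (hylim.comp hnat).congr' ?_
    filter_upwards [eventually_ge_atTop (0 : ℤ)] with i hi
    simp [hi]
  · dsimp only
    rcases le_or_gt 0 i with hi | hi
    · lift i to ℕ using hi
      have hi' : (0 : ℤ) ≤ (i : ℤ) + 1 := by omega
      have hn : ((i : ℤ) + 1).toNat = i + 1 := by omega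
      rw [if_pos (Int.natCast_nonneg i), if_pos hi', hn, Int.toNat_natCast,
        crossRatio_swap_middle]
      exact abs_log_inv_le_log_one_div h1 (hy i).1 ((hy i).2.trans h2.le)
    · obtain ⟨n, rfl⟩ : ∃ n : ℕ, i = -((n : ℤ) + 1) := ⟨(-i - 1).toNat, by omega⟩
      have hnext : (if 0 ≤ -((n : ℤ) + 1) + 1 then y (-((n : ℤ) + 1) + 1).toNat
          else z (-(-((n : ℤ) + 1) + 1)).toNat) = z n := by
        split_ifs with h0
        · obtain rfl : n = 0 := by omega
          simp [hy0, hz0]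
        · congr 1
          omega
      have hn : (-(-((n : ℤ) + 1))).toNat = n + 1 := by omega
      rw [hnext, if_neg (not_le.2 hi), hn, hρ.crossRatio_swap_ends b]
      exact abs_log_inv_le_log_one_div h1 (hz n).1 ((hz n).2.trans h2.le)
end

section
/- Let (Z₁,ρ₁) be a K₁-quasi-metric space, (Z₂,ρ₂) a K₂-quasi-metric space, and f : Z₁ → Z₂ a θ-quasimöbius bijection. If (Z₁,ρ₁) is μ-uniformly perfect and contains at least two points, then (Z₂,ρ₂) is μ'-uniformly perfect for a constant μ' ∈ (0,1) depending only on μ, θ, K₁ and K₂. -/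
open Filter Topology

universe u v

theorem IsQuasiMetric.ne_of_pos {Z : Type*} {K : ℝ} {ρ : Z → Z → ℝ} (h : IsQuasiMetric K ρ)
    {x y : Z} (hxy : 0 < ρ x y) : x ≠ y := fun h0 =>
  hxy.ne' ((h.2.1 x y).2 h0)

/-- If `y` is much closer to `x` than `z` is, then `ρ(y,z)` is comparable to `ρ(x,z)`. -/
theorem IsQuasiMetric.le_mul_of_lt {Z : Type*} {K : ℝ} {ρ : Z → Z → ℝ} (hK : 0 ≤ K)
    (h : IsQuasiMetric K ρ) {x y z : Z} (hlt : K * ρ x y < ρ x z) : ρ x z ≤ K * ρ y z := by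
  have := h.2.2.2 x y z
  rw [mul_max_of_nonneg _ _ hK] at this
  exact (le_max_iff.1 this).resolve_left hlt.not_ge

theorem UniformlyPerfectWith.noIsolatedPoints {Z : Type*} {K μ : ℝ} {ρ : Z → Z → ℝ}
    (hρ : IsQuasiMetric K ρ) (hμ : 0 < μ) (hup : UniformlyPerfectWith ρ μ)
    (hne : ∃ x y : Z, x ≠ y) : NoIsolatedPoints ρ := by
  intro x r hr
  have : Nontrivial Z := ⟨hne⟩
  obtain ⟨z, hz⟩ := exists_ne x
  have hpos := lt_min hr (hρ.pos hz.symm)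
  obtain ⟨y, hy, hy'⟩ := hup x _ hpos ⟨z, min_le_right _ _⟩
  exact ⟨y, (hρ.ne_of_pos ((mul_pos hμ hpos).trans_le hy)).symm,
    hy'.trans_le (min_le_left _ _)⟩

/-- A quasimöbius bijection maps spaces without isolated points to such spaces. -/
theorem QuasiMobius.noIsolatedPoints {Z₁ Z₂ : Type*} {K₁ K₂ : ℝ} {θ : ℝ → ℝ}
    {ρ₁ : Z₁ → Z₁ → ℝ} {ρ₂ : Z₂ → Z₂ → ℝ} {f : Z₁ → Z₂} (hK₁ : 1 ≤ K₁) (hK₂ : 1 ≤ K₂)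
    (hθ : ControlFun θ) (h₁ : IsQuasiMetric K₁ ρ₁) (h₂ : IsQuasiMetric K₂ ρ₂)
    (hf : Function.Bijective f) (hqm : QuasiMobius ρ₁ ρ₂ f θ) (hni : NoIsolatedPoints ρ₁) :
    NoIsolatedPoints ρ₂ := by
  intro x' r hr
  obtain ⟨x, rfl⟩ := hf.2 x'
  by_contra! hiso
  obtain ⟨c, hcx, -⟩ := hni x 1 one_pos
  obtain ⟨d, hdx, hdc⟩ := hni x _ (h₁.pos hcx.symm)
  have hcd : c ≠ d := by rintro rfl; exact lt_irrefl _ hdc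
  have hxc := h₁.pos hcx.symm
  have hxd := h₁.pos hdx.symm
  have hcd1 := h₁.pos hcd
  have hxc2 := h₂.pos (hf.1.ne hcx.symm)
  have hcd2 := h₂.pos (hf.1.ne hcd)
  have hK₁' : 0 < K₁ := by linarith
  have hK₂' : 0 < K₂ := by linarith
  set m := max 1 (ρ₂ (f x) (f d) / r) with hm
  have hm0 : 0 < m := lt_of_lt_of_le one_pos (le_max_left _ _)
  set κ := ρ₂ (f c) (f d) / (ρ₂ (f x) (f c) * (K₂ * m)) with hκ
  have hκ0 : 0 < κ := by positivity
  obtain ⟨t, ht, htκ⟩ := hθ.2.2.2 κ hκ0.le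
  have ht0 : 0 < t := by
    refine lt_of_le_of_ne ht ?_
    rintro rfl
    rw [hθ.1] at htκ
    linarith
  obtain ⟨y, hyx, hy⟩ := hni x
    (min (ρ₁ x d / K₁) (t * (ρ₁ x c * ρ₁ x d) / (K₁ * ρ₁ c d))) (by positivity)
  rw [lt_min_iff, lt_div_iff₀ hK₁', lt_div_iff₀ (by positivity)] at hy
  obtain ⟨hy1, hy2⟩ := hy
  have hxy := h₁.pos hyx.symm
  have hyd' : ρ₁ x y < ρ₁ x d := by nlinarith
  have hyd : y ≠ d := by rintro rfl; exact lt_irrefl _ hyd'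
  have hyc : c ≠ y := by rintro rfl; exact lt_irrefl _ (hyd'.trans hdc)
  have hyd1 := h₁.pos hyd
  have hcomp := h₁.le_mul_of_lt hK₁'.le (x := x) (y := y) (z := d) (by linarith)
  have hcr := hqm x c y d hcx.symm hyx.symm hdx.symm hyc hcd hyd
  have hlt : crossRatio ρ₁ x c y d < t := by
    unfold crossRatio
    rw [div_lt_iff₀ (by positivity)]
    have : t * (ρ₁ x c * ρ₁ x d) ≤ t * (ρ₁ x c * (K₁ * ρ₁ y d)) := by gcongr
    nlinarith
  have hcr0 : 0 ≤ crossRatio ρ₁ x c y d := by unfold crossRatio; positivity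
  have hθlt := hθ.2.1 hcr0 ht hlt
  rw [htκ] at hθlt
  have hyd2 := h₂.pos (hf.1.ne hyd)
  have hxy2 := h₂.pos (hf.1.ne hyx.symm)
  have hry : r ≤ ρ₂ (f x) (f y) := hiso _ (hf.1.ne hyx)
  have hup : ρ₂ (f y) (f d) ≤ K₂ * m * ρ₂ (f x) (f y) := by
    have h := h₂.2.2.2 (f y) (f x) (f d)
    rw [h₂.2.2.1 (f y) (f x)] at h
    refine h.trans ?_
    rw [mul_assoc]
    gcongr
    refine max_le ?_ ?_
    · exact le_mul_of_one_le_left hxy2.le (le_max_left _ _)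
    · calc ρ₂ (f x) (f d) = ρ₂ (f x) (f d) / r * r := by field_simp
        _ ≤ m * ρ₂ (f x) (f y) := by
          gcongr
          exact le_max_right _ _
  have hge : κ ≤ crossRatio ρ₂ (f x) (f c) (f y) (f d) := by
    unfold crossRatio
    rw [hκ, div_le_div_iff₀ (by positivity) (by positivity)]
    calc ρ₂ (f c) (f d) * (ρ₂ (f x) (f c) * ρ₂ (f y) (f d))
        ≤ ρ₂ (f c) (f d) * (ρ₂ (f x) (f c) * (K₂ * m * ρ₂ (f x) (f y))) := by gcongr
      _ = _ := by ring
  linarith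

/-- In a uniformly perfect space, if the complement `B` of `A` is far from `A` in terms of cross
ratios, then `B` lies in a ball which is small compared to its distance from `a`. -/
theorem UniformlyPerfectWith.exists_center {Z : Type*} {K μ T : ℝ} {ρ : Z → Z → ℝ}
    (hK : 1 ≤ K) (hμ0 : 0 < μ) (hT0 : 0 < T) (hT : 2 * K ^ 2 < T * μ)
    (hρ : IsQuasiMetric K ρ) (hup : UniformlyPerfectWith ρ μ) {A B : Set Z}
    (hAB : ∀ z, z ∈ A ∨ z ∈ B)
    (hsep : ∀ a ∈ A, ∀ a' ∈ A, ∀ b ∈ B, ∀ b' ∈ B,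
      T * (ρ a a' * ρ b b') ≤ ρ a b * ρ a' b')
    {a a' b b' : Z} (ha : a ∈ A) (ha' : a' ∈ A) (hb : b ∈ B) (hb' : b' ∈ B)
    (haa : a ≠ a') (hbb : b ≠ b') :
    ∃ δ, 0 < δ ∧ ∃ c ∈ B, ρ a c ≤ 2 * δ ∧ (∀ z ∈ B, δ ≤ ρ a z) ∧
      (∀ z ∈ B, T * μ * ρ c z ≤ 4 * K ^ 2 * δ) ∧ ∃ y ∈ A, μ * δ ≤ ρ a y := by
  have hK0 : 0 < K := by linarith
  have hbdd : BddBelow (ρ a '' B) := ⟨0, by rintro _ ⟨z, -, rfl⟩; exact hρ.1 _ _⟩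
  set δ := sInf (ρ a '' B) with hδ
  have hδle : ∀ z ∈ B, δ ≤ ρ a z := fun z hz => csInf_le hbdd ⟨z, hz, rfl⟩
  have hs := hρ.pos haa
  have ht := hρ.pos hbb
  have hD : 0 < max (ρ a' b) (ρ a' b') := by
    have h := hρ.2.2.2 b a' b'
    rw [hρ.2.2.1 b a'] at h
    by_contra! hle
    nlinarith
  have hδ0 : 0 < δ := by
    have hlow : 0 < T * (ρ a a' * ρ b b') / (K * max (ρ a' b) (ρ a' b')) := by positivity
    refine hlow.trans_le (le_csInf ⟨_, b, hb, rfl⟩ ?_)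
    rintro _ ⟨z, hz, rfl⟩
    rw [div_le_iff₀ (by positivity)]
    obtain ⟨u, hu, htu, huD⟩ :
        ∃ u ∈ B, ρ b b' ≤ K * ρ z u ∧ ρ a' u ≤ max (ρ a' b) (ρ a' b') := by
      have h := hρ.2.2.2 b z b'
      rw [mul_max_of_nonneg _ _ hK0.le, hρ.2.2.1 b z] at h
      rcases le_max_iff.1 h with h | h
      · exact ⟨b, hb, h, le_max_left _ _⟩
      · exact ⟨b', hb', h, le_max_right _ _⟩
    have haz := hρ.1 a z
    calc T * (ρ a a' * ρ b b') ≤ T * (ρ a a' * (K * ρ z u)) := by gcongr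
      _ = K * (T * (ρ a a' * ρ z u)) := by ring
      _ ≤ K * (ρ a z * ρ a' u) := by gcongr K * ?_; exact hsep a ha a' ha' z hz u hu
      _ ≤ K * (ρ a z * max (ρ a' b) (ρ a' b')) := by gcongr
      _ = _ := by ring
  obtain ⟨y, hy, hyδ⟩ := hup a δ hδ0 ⟨b, hδle b hb⟩
  have hyA : y ∈ A := (hAB y).resolve_right fun h => (hδle y h).not_gt hyδ
  obtain ⟨_, ⟨c, hc, rfl⟩, hcδ⟩ := exists_lt_of_csInf_lt (Set.Nonempty.image (ρ a) ⟨b, hb⟩)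
    (show sInf (ρ a '' B) < 2 * δ by linarith)
  have hyc : ρ y c ≤ 2 * K * δ := by
    have h := hρ.2.2.2 y a c
    rw [hρ.2.2.1 y a] at h
    have : max (ρ a y) (ρ a c) ≤ 2 * δ := max_le (by linarith) hcδ.le
    nlinarith
  have hball : ∀ z ∈ B, T * μ * ρ c z ≤ 2 * K * ρ a z := by
    intro z hz
    have h := hsep a ha y hyA z hz c hc
    rw [hρ.2.2.1 z c] at h
    have h1 : T * (μ * δ * ρ c z) ≤ T * (ρ a y * ρ c z) := by
      have := hρ.1 c z
      gcongr
    have h2 : ρ a z * ρ y c ≤ ρ a z * (2 * K * δ) := by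
      have := hρ.1 a z
      gcongr
    refine le_of_mul_le_mul_right ?_ hδ0
    linarith
  refine ⟨δ, hδ0, c, hc, hcδ.le, hδle, fun z hz => ?_, y, hyA, hy⟩
  have hzpos : 0 < ρ a z := hδ0.trans_le (hδle z hz)
  have hz2 : ρ a z ≤ K * (2 * δ) := by
    by_contra! hlt
    have h := hρ.2.2.2 a c z
    rcases le_total (ρ a c) (ρ c z) with hcz | hcz
    · rw [max_eq_right hcz] at h
      have h3 := hball z hz
      have h4 : T * μ * ρ a z ≤ T * μ * (K * ρ c z) := by gcongr
      nlinarith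
    · rw [max_eq_left hcz] at h
      nlinarith
  have h3 := hball z hz
  nlinarith

/-- A uniformly perfect space has no partition into two nondegenerate pieces that are far apart in
terms of cross ratios. -/
theorem UniformlyPerfectWith.not_separated {Z : Type*} {K μ T : ℝ} {ρ : Z → Z → ℝ}
    (hK : 1 ≤ K) (hμ0 : 0 < μ) (hμ1 : μ < 1) (hT : 8 * K ^ 3 < T * μ ^ 2)
    (hρ : IsQuasiMetric K ρ) (hup : UniformlyPerfectWith ρ μ) {A B : Set Z}
    (hAB : ∀ z, z ∈ A ∨ z ∈ B) (hA : A.Nontrivial) (hB : B.Nontrivial)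
    (hsep : ∀ a ∈ A, ∀ a' ∈ A, ∀ b ∈ B, ∀ b' ∈ B,
      T * (ρ a a' * ρ b b') ≤ ρ a b * ρ a' b') : False := by
  have hK0 : 0 < K := by linarith
  have hT0 : 0 < T := by
    refine pos_of_mul_pos_left (b := μ ^ 2) ?_ (by positivity)
    linarith [pow_pos hK0 3]
  have hT' : 2 * K ^ 2 < T * μ := by
    have h1 : K ^ 2 ≤ K ^ 3 := pow_le_pow_right₀ hK (by norm_num)
    have h2 : T * μ ^ 2 ≤ T * μ := by gcongr; nlinarith
    have : 0 < K ^ 2 := by positivity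
    linarith
  have hsep' : ∀ b ∈ B, ∀ b' ∈ B, ∀ a ∈ A, ∀ a' ∈ A,
      T * (ρ b b' * ρ a a') ≤ ρ b a * ρ b' a' := by
    intro b hb b' hb' a ha a' ha'
    rw [mul_comm (ρ b b'), hρ.2.2.1 b a, hρ.2.2.1 b' a']
    exact hsep a ha a' ha' b hb b' hb'
  obtain ⟨a, ha, a', ha', haa⟩ := hA
  obtain ⟨b, hb, b', hb', hbb⟩ := hB
  obtain ⟨δ, hδ0, c, hc, hac, -, -, y, hy, hay⟩ :=
    hup.exists_center hK hμ0 hT0 hT' hρ hAB hsep ha ha' hb hb' haa hbb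
  obtain ⟨d, hd, hdc⟩ := Set.Nontrivial.exists_ne ⟨b, hb, b', hb', hbb⟩ c
  obtain ⟨δ', -, e, he, -, hδ', hball, -⟩ :=
    hup.exists_center hK hμ0 hT0 hT' hρ (fun z => (hAB z).symm) hsep' hc hd ha ha' hdc.symm haa
  have hδδ : δ' ≤ 2 * δ := by
    have h := hδ' a ha
    rw [hρ.2.2.1 c a] at h
    exact h.trans hac
  have hmax : T * μ * max (ρ a e) (ρ e y) ≤ 4 * K ^ 2 * δ' := by
    rw [mul_max_of_nonneg _ _ (by positivity), hρ.2.2.1 a e]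
    exact max_le (hball a ha) (hball y hy)
  have hchain : T * μ ^ 2 * δ ≤ 8 * K ^ 3 * δ := by
    calc T * μ ^ 2 * δ = T * μ * (μ * δ) := by ring
      _ ≤ T * μ * (K * max (ρ a e) (ρ e y)) := by
        gcongr T * μ * ?_
        exact hay.trans (hρ.2.2.2 a e y)
      _ = K * (T * μ * max (ρ a e) (ρ e y)) := by ring
      _ ≤ K * (4 * K ^ 2 * (2 * δ)) := by
        gcongr K * ?_
        exact hmax.trans (by gcongr)
      _ = 8 * K ^ 3 * δ := by ring
  exact (le_of_mul_le_mul_right hchain hδ0).not_gt hT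

/-- Points close to `x` are separated, in terms of cross ratios, from points far from `x`. -/
theorem IsQuasiMetric.mul_le_of_gap {Z : Type*} {K ν r : ℝ} {ρ : Z → Z → ℝ} (hK : 1 ≤ K)
    (hν : K * ν < 1) (hr : 0 < r) (hρ : IsQuasiMetric K ρ) {x a a' b b' : Z}
    (ha : ρ x a < ν * r) (ha' : ρ x a' < ν * r) (hb : r ≤ ρ x b) (hb' : r ≤ ρ x b') :
    ρ a a' * ρ b b' ≤ K ^ 4 * ν * (ρ a b * ρ a' b') := by
  have hK0 : 0 < K := by linarith
  have hν0 : 0 < ν := pos_of_mul_pos_left ((hρ.1 x a).trans_lt ha) hr.le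
  have hgap : ∀ {p q : Z}, ρ x p < ν * r → r ≤ ρ x q → ρ x q ≤ K * ρ p q := by
    intro p q hp hq
    refine hρ.le_mul_of_lt hK0.le ?_
    nlinarith
  have h1 : ρ a a' ≤ K * (ν * r) := by
    refine (hρ.2.2.2 a x a').trans ?_
    rw [hρ.2.2.1 a x]
    gcongr
    exact max_le ha.le ha'.le
  have hbx := hρ.1 x b
  have hbx' := hρ.1 x b'
  have h2 : r * ρ b b' ≤ K * (ρ x b * ρ x b') := by
    have h := hρ.2.2.2 b x b'
    rw [hρ.2.2.1 b x] at h
    have hm : r * max (ρ x b) (ρ x b') ≤ ρ x b * ρ x b' := by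
      rw [mul_max_of_nonneg _ _ hr.le]
      exact max_le (by nlinarith) (by nlinarith)
    nlinarith
  have hbb := hρ.1 b b'
  calc ρ a a' * ρ b b' ≤ K * (ν * r) * ρ b b' := by gcongr
    _ = K * ν * (r * ρ b b') := by ring
    _ ≤ K * ν * (K * (ρ x b * ρ x b')) := by gcongr
    _ ≤ K * ν * (K * ((K * ρ a b) * (K * ρ a' b'))) := by
      have := hgap ha hb
      have := hgap ha' hb'
      have := hρ.1 a b
      gcongr
    _ = K ^ 4 * ν * (ρ a b * ρ a' b') := by ring

/-- quasimöbius maps preserve uniform perfectness, quantitatively. -/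
theorem stmt6 (K₁ K₂ μ : ℝ) (θ : ℝ → ℝ) (hK₁ : 1 ≤ K₁) (hK₂ : 1 ≤ K₂)
    (hμ0 : 0 < μ) (hμ1 : μ < 1) (hθ : ControlFun θ) :
    ∃ μ' : ℝ, 0 < μ' ∧ μ' < 1 ∧
      ∀ {Z₁ : Type u} {Z₂ : Type v} (ρ₁ : Z₁ → Z₁ → ℝ) (ρ₂ : Z₂ → Z₂ → ℝ) (f : Z₁ → Z₂),
        IsQuasiMetric K₁ ρ₁ → IsQuasiMetric K₂ ρ₂ → Function.Bijective f →
        QuasiMobius ρ₁ ρ₂ f θ → UniformlyPerfectWith ρ₁ μ → (∃ x y : Z₁, x ≠ y) →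
        UniformlyPerfectWith ρ₂ μ' := by
  have hK₁0 : 0 < K₁ := by linarith
  have hK₂0 : 0 < K₂ := by linarith
  set T := 9 * K₁ ^ 3 / μ ^ 2 with hT
  have hT0 : 0 < T := by positivity
  have hTμ : 8 * K₁ ^ 3 < T * μ ^ 2 := by
    have h : T * μ ^ 2 = 9 * K₁ ^ 3 := by rw [hT]; field_simp
    linarith [pow_pos hK₁0 3]
  have hθT : 0 < θ T := by
    rw [← hθ.1]
    exact hθ.2.1 Set.self_mem_Ici hT0.le hT0
  set ν := 1 / (K₂ ^ 4 * (θ T + 1)) with hν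
  have hν0 : 0 < ν := by positivity
  have hνeq : K₂ ^ 4 * ν * (θ T + 1) = 1 := by rw [hν]; field_simp
  have hKν : K₂ * ν < 1 := by
    have h1 : K₂ ≤ K₂ ^ 4 := le_self_pow₀ hK₂ (by norm_num)
    have h2 : K₂ * ν ≤ K₂ ^ 4 * ν := by gcongr
    have h3 : 0 < K₂ ^ 4 * ν * θ T := by positivity
    linarith
  have hν1 : ν < 1 := by nlinarith
  refine ⟨ν, hν0, hν1, ?_⟩
  intro Z₁ Z₂ ρ₁ ρ₂ f h₁ h₂ hf hqm hup hne x' r hr hz'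
  by_contra! hgap
  obtain ⟨z', hz'⟩ := hz'
  have hni := hqm.noIsolatedPoints hK₁ hK₂ hθ h₁ h₂ hf (hup.noIsolatedPoints h₁ hμ0 hne)
  have hcover : ∀ w, ρ₂ x' w < ν * r ∨ r ≤ ρ₂ x' w := fun w =>
    (lt_or_ge _ _).imp_right (hgap w)
  refine hup.not_separated (T := T) (A := f ⁻¹' {w | ρ₂ x' w < ν * r})
    (B := f ⁻¹' {w | r ≤ ρ₂ x' w}) hK₁ hμ0 hμ1 hTμ h₁ (fun z => hcover (f z)) ?_ ?_ ?_
  · refine Set.Nontrivial.preimage ?_ hf.2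
    obtain ⟨w, hw, hwr⟩ := hni x' (ν * r) (by positivity)
    refine ⟨w, hwr, x', ?_, hw⟩
    rw [Set.mem_ofPred_eq, (h₂.2.1 x' x').2 rfl]
    positivity
  · refine Set.Nontrivial.preimage ?_ hf.2
    obtain ⟨w, hw, hwr⟩ := hni z' (r / K₂) (by positivity)
    rw [lt_div_iff₀ hK₂0] at hwr
    refine ⟨w, (hcover w).resolve_left fun hlt => ?_, z', hz', hw⟩
    have h := h₂.le_mul_of_lt hK₂0.le (x := x') (y := w) (z := z') (by nlinarith)
    rw [h₂.2.2.1 w z'] at h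
    linarith
  · intro a ha a' ha' b hb b' hb'
    have hne : ∀ {p q : Z₁}, ρ₂ x' (f p) < ν * r → r ≤ ρ₂ x' (f q) → p ≠ q := by
      rintro p q hp hq rfl
      nlinarith
    have hpos := mul_nonneg (h₁.1 a b) (h₁.1 a' b')
    by_cases haa : a = a'
    · rwa [(h₁.2.1 a a').2 haa, zero_mul, mul_zero]
    by_cases hbb : b = b'
    · rwa [(h₁.2.1 b b').2 hbb, mul_zero, mul_zero]
    have hd₁ := mul_pos (h₁.pos haa) (h₁.pos hbb)
    have hd₂ := mul_pos (h₂.pos (hf.1.ne haa)) (h₂.pos (hf.1.ne hbb))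
    have hsep := h₂.mul_le_of_gap hK₂ hKν hr ha ha' hb hb'
    have hcr := hqm a a' b b' haa (hne ha hb) (hne ha hb') (hne ha' hb) (hne ha' hb') hbb
    have hge : θ T + 1 ≤ crossRatio ρ₂ (f a) (f a') (f b) (f b') := by
      unfold crossRatio
      rw [le_div_iff₀ hd₂]
      calc _ ≤ (θ T + 1) * (K₂ ^ 4 * ν * (ρ₂ (f a) (f b) * ρ₂ (f a') (f b'))) := by gcongr
        _ = K₂ ^ 4 * ν * (θ T + 1) * (ρ₂ (f a) (f b) * ρ₂ (f a') (f b')) := by ring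
        _ = _ := by rw [hνeq, one_mul]
    rw [← le_div_iff₀ hd₁]
    by_contra! hlt
    have := hθ.2.1 (div_nonneg hpos hd₁.le) hT0.le hlt
    unfold crossRatio at hcr hge
    linarith
end

section
/- Let (Z,ρ) be a μ-uniformly perfect K-quasi-metric space with no isolated points. Then every θ-quasimöbius bijection f from (Z,ρ) onto a K'-quasi-metric space (Z₂,ρ₂) is power quasimöbius, i.e., f is θ'-quasimöbius with θ'(t) = M·max(t^{1/β}, t^β) for constants β ≥ 1 and M ≥ 1 depending only on μ, θ, K and K'. -/
open Filter Topology

universe u v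

theorem crossRatio_eq_div_div {Z : Type*} (ρ : Z → Z → ℝ) (a b c d : Z) :
    crossRatio ρ a b c d = (ρ a c / ρ c d) / (ρ a b / ρ b d) := by
  rw [crossRatio, div_div_div_eq, mul_comm (ρ c d)]

/-- In a uniformly perfect space, the ratio of the distances to two distinct points `a`, `d`
takes values comparable to any given `s ≤ 1`. -/
theorem UniformlyPerfectWith.exists_ratio_of_le_one {Z : Type*} {K μ : ℝ} {ρ : Z → Z → ℝ}
    (hK : 1 ≤ K) (hμ : 0 < μ) (hρ : IsQuasiMetric K ρ) (hup : UniformlyPerfectWith ρ μ)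
    {a d : Z} (had : a ≠ d) {s : ℝ} (hs : 0 < s) (hs1 : s ≤ 1) :
    ∃ x, x ≠ a ∧ x ≠ d ∧ μ / K ^ 2 * s ≤ ρ a x / ρ x d ∧ ρ a x / ρ x d ≤ s := by
  have hK0 : 0 < K := by linarith
  have hD : 0 < ρ a d := hρ.pos had
  have hrpos : 0 < s * ρ a d / K := by positivity
  have hKr : K * (s * ρ a d / K) = s * ρ a d := by field_simp
  have hsD : s * ρ a d ≤ ρ a d := by nlinarith
  have hr : s * ρ a d / K ≤ ρ a d := (div_le_self (by positivity) hK).trans hsD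
  obtain ⟨x, hx1, hx2⟩ := hup a _ hrpos ⟨d, hr⟩
  have hax : 0 < ρ a x := lt_of_lt_of_le (by positivity) hx1
  have hKx : K * ρ a x < ρ a d := by nlinarith
  have hDx : ρ a d ≤ K * ρ x d := by
    have h := hρ.2.2.2 a x d
    rcases max_choice (ρ a x) (ρ x d) with h' | h' <;> rw [h'] at h <;> linarith
  have hxd : 0 < ρ x d := by
    by_contra! h
    nlinarith
  have hxD : ρ x d ≤ K * ρ a d := by
    refine (hρ.2.2.2 x a d).trans (mul_le_mul_of_nonneg_left ?_ hK0.le)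
    rw [hρ.2.2.1 x a]
    exact max_le (hx2.le.trans hr) le_rfl
  refine ⟨x, ?_, ?_, ?_, ?_⟩
  · rintro rfl
    exact hax.ne' ((hρ.2.1 x x).2 rfl)
  · rintro rfl
    exact hxd.ne' ((hρ.2.1 x x).2 rfl)
  · rw [le_div_iff₀ hxd]
    calc μ / K ^ 2 * s * ρ x d ≤ μ / K ^ 2 * s * (K * ρ a d) := by gcongr
      _ = μ * (s * ρ a d / K) := by field_simp
      _ ≤ ρ a x := hx1
  · rw [div_le_iff₀ hxd]
    calc ρ a x ≤ s * ρ a d / K := hx2.le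
      _ ≤ s * (K * ρ x d) / K := by gcongr
      _ = s * ρ x d := by field_simp

theorem UniformlyPerfectWith.exists_ratio {Z : Type*} {K μ : ℝ} {ρ : Z → Z → ℝ}
    (hK : 1 ≤ K) (hμ : 0 < μ) (hμ1 : μ ≤ 1) (hρ : IsQuasiMetric K ρ)
    (hup : UniformlyPerfectWith ρ μ) {a d : Z} (had : a ≠ d) {s : ℝ} (hs : 0 < s) :
    ∃ x, x ≠ a ∧ x ≠ d ∧ (μ / K ^ 2) ^ 2 * s ≤ ρ a x / ρ x d ∧ ρ a x / ρ x d ≤ s := by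
  have hK0 : 0 < K := by linarith
  have hk : 0 < μ / K ^ 2 := by positivity
  have hk1 : μ / K ^ 2 ≤ 1 := div_le_one_of_le₀ (by nlinarith) (by positivity)
  obtain ⟨k, hkdef⟩ : ∃ k, μ / K ^ 2 = k := ⟨_, rfl⟩
  rw [hkdef] at hk hk1 ⊢
  have hkk : k ^ 2 ≤ k := by nlinarith
  rcases le_total s 1 with h1 | h1
  · obtain ⟨x, hxa, hxd, hx1, hx2⟩ := hup.exists_ratio_of_le_one hK hμ hρ had hs h1
    rw [hkdef] at hx1
    exact ⟨x, hxa, hxd, (by gcongr : k ^ 2 * s ≤ k * s).trans hx1, hx2⟩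
  rcases le_total (k * s) 1 with h2 | h2
  · obtain ⟨x, hxa, hxd, hx1, hx2⟩ := hup.exists_ratio_of_le_one hK hμ hρ had one_pos le_rfl
    rw [hkdef] at hx1
    exact ⟨x, hxa, hxd, by nlinarith, hx2.trans h1⟩
  · obtain ⟨x, hxd, hxa, hx1, hx2⟩ := hup.exists_ratio_of_le_one hK hμ hρ had.symm
      (s := (k * s)⁻¹) (by positivity) (inv_le_one_of_one_le₀ h2)
    have hinv : ρ a x / ρ x d = (ρ d x / ρ x a)⁻¹ := by
      rw [inv_div, hρ.2.2.1 a x, hρ.2.2.1 x d]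
    have hpos : 0 < ρ d x / ρ x a := div_pos (hρ.pos hxd.symm) (hρ.pos hxa)
    refine ⟨x, hxa, hxd, ?_, ?_⟩
    · rw [hinv]
      calc k ^ 2 * s ≤ k * s := by gcongr
        _ ≤ _ := (le_inv_comm₀ (by positivity) hpos).2 hx2
    · rw [hinv]
      refine inv_le_of_inv_le₀ hs (le_of_eq_of_le ?_ hx1)
      rw [hkdef]
      field_simp

/-- If `g` takes values comparable to every positive number, and the ratios of `G` grow by at most
a factor `A` whenever those of `g` grow by at most `2 / l`, then they grow polynomially. -/
theorem div_le_pow_of_le_two_pow {S : Type*} {g G : S → ℝ} {l A : ℝ} (hl : 0 < l) (hA : 1 ≤ A)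
    (hg : ∀ x, 0 < g x) (hG : ∀ x, 0 < G x)
    (hd : ∀ s : ℝ, 0 < s → ∃ x, l * s ≤ g x ∧ g x ≤ s)
    (hstep : ∀ b c, g c / g b ≤ 2 / l → G c / G b ≤ A) (hl1 : l ≤ 1) (n : ℕ) :
    ∀ b c, g c / g b ≤ 2 ^ n → G c / G b ≤ A ^ (n + 1) := by
  induction n with
  | zero =>
    intro b c h
    rw [zero_add, pow_one]
    refine hstep b c (h.trans ?_)
    rw [pow_zero, one_le_div hl]
    linarith
  | succ n ih =>
    intro b c h
    have hb := hg b
    obtain ⟨x, hx1, hx2⟩ := hd (2 / l * g b) (by positivity)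
    have h2 : l * (2 / l * g b) = 2 * g b := by field_simp
    rw [h2] at hx1
    have hxc : g c / g x ≤ 2 ^ n := by
      rw [div_le_iff₀ hb] at h
      rw [div_le_iff₀ (hg x)]
      calc g c ≤ 2 ^ n * (2 * g b) := by rw [pow_succ] at h; linarith
        _ ≤ 2 ^ n * g x := by gcongr
    have hbx := hstep b x ((div_le_iff₀ hb).2 hx2)
    calc G c / G b = G c / G x * (G x / G b) := (div_mul_div_cancel₀ (hG x).ne').symm
      _ ≤ A ^ (n + 1) * A :=
        mul_le_mul (ih x c hxc) hbx (div_pos (hG x) (hG b)).le (by positivity)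
      _ = A ^ (n + 1 + 1) := (pow_succ _ _).symm

/-- If `g` takes values comparable to every positive number, and the ratios of `G` drop by a
factor `2` whenever those of `g` drop by `δ`, then they decay polynomially. -/
theorem div_le_mul_half_pow {S : Type*} {g G : S → ℝ} {l A δ : ℝ} (hδ : 0 < δ)
    (hA : 0 ≤ A) (hg : ∀ x, 0 < g x) (hG : ∀ x, 0 < G x)
    (hd : ∀ s : ℝ, 0 < s → ∃ x, l * s ≤ g x ∧ g x ≤ s)
    (hone : ∀ b c, g c / g b ≤ 1 → G c / G b ≤ A)
    (hstep : ∀ b c, g c / g b ≤ δ → G c / G b ≤ 1 / 2) (hl : 0 < l) (n : ℕ) :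
    ∀ b c, g c / g b ≤ (l * δ) ^ n → G c / G b ≤ A * (1 / 2) ^ n := by
  induction n with
  | zero => simpa using hone
  | succ n ih =>
    intro b c h
    have hb := hg b
    obtain ⟨x, hx1, hx2⟩ := hd (δ * g b) (by positivity)
    have hxc : g c / g x ≤ (l * δ) ^ n := by
      rw [div_le_iff₀ hb] at h
      rw [div_le_iff₀ (hg x)]
      calc g c ≤ (l * δ) ^ n * (l * (δ * g b)) := by rw [pow_succ] at h; linarith
        _ ≤ (l * δ) ^ n * g x := by gcongr
    have hbx := hstep b x ((div_le_iff₀ hb).2 hx2)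
    calc G c / G b = G c / G x * (G x / G b) := (div_mul_div_cancel₀ (hG x).ne').symm
      _ ≤ A * (1 / 2) ^ n * (1 / 2) :=
        mul_le_mul (ih x c hxc) hbx (div_pos (hG x) (hG b)).le (by positivity)
      _ = A * (1 / 2) ^ (n + 1) := by ring

/-- A power-type control function is available for any pair `g`, `G` controlled by `θ`. -/
theorem exists_power_control {θ : ℝ → ℝ} (hθ : ControlFun θ) {l : ℝ} (hl : 0 < l) (hl1 : l ≤ 1) :
    ∃ β M : ℝ, 1 ≤ β ∧ 1 ≤ M ∧ ∀ {S : Type u} (g G : S → ℝ), (∀ x, 0 < g x) → (∀ x, 0 < G x) →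
      (∀ s : ℝ, 0 < s → ∃ x, l * s ≤ g x ∧ g x ≤ s) →
      (∀ b c, b ≠ c → G c / G b ≤ θ (g c / g b)) →
      ∀ b c, G c / G b ≤ M * max ((g c / g b) ^ (1 / β)) ((g c / g b) ^ β) := by
  obtain ⟨hθ0, hmono, -, hsurj⟩ := hθ
  obtain ⟨δ₀, hδ₀, hθδ₀⟩ := hsurj (1 / 2) (by norm_num)
  have hδ₀pos : 0 < δ₀ := lt_of_le_of_ne hδ₀ fun h => by
    rw [← h, hθ0] at hθδ₀
    norm_num at hθδ₀
  set δ := min δ₀ (1 / 2) with hδdef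
  have hδ : 0 < δ := lt_min hδ₀pos (by norm_num)
  have hδ1 : δ ≤ 1 / 2 := min_le_right _ _
  set A := max 1 (θ (2 / l)) with hAdef
  have hA : 1 ≤ A := le_max_left _ _
  have hA0 : 0 < A := by linarith
  set ε := l * δ with hεdef
  have hε : 0 < ε := by positivity
  have hε1 : ε < 1 := by nlinarith
  set p := Real.logb 2 A with hpdef
  set q := Real.logb ε (1 / 2) with hqdef
  have hq : 0 < q := Real.logb_pos_of_base_lt_one hε hε1 (by norm_num) (by norm_num)
  have hβ1 : (1 : ℝ) ≤ max 1 (max p (1 / q)) := le_max_left _ _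
  refine ⟨max 1 (max p (1 / q)), 2 * A ^ 2, hβ1, by nlinarith, ?_⟩
  intro S g G hg hG hd hctrl b c
  have hpβ : p ≤ max 1 (max p (1 / q)) := (le_max_left _ _).trans (le_max_right _ _)
  have hqβ : 1 / q ≤ max 1 (max p (1 / q)) := (le_max_right _ _).trans (le_max_right _ _)
  generalize max 1 (max p (1 / q)) = β at hβ1 hpβ hqβ ⊢
  have hβq : 1 / β ≤ q := (one_div_le (by linarith) hq).2 hqβ
  have hstepA : ∀ b c, g c / g b ≤ 2 / l → G c / G b ≤ A := by
    intro b c h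
    rcases eq_or_ne b c with rfl | hbc
    · rwa [div_self (hG b).ne']
    · exact (hctrl b c hbc).trans ((hmono.monotoneOn (div_pos (hg c) (hg b)).le
        (by simp only [Set.mem_Ici]; positivity) h).trans (le_max_right _ _))
  have hstepδ : ∀ b c, g c / g b ≤ δ → G c / G b ≤ 1 / 2 := by
    intro b c h
    rcases eq_or_ne b c with rfl | hbc
    · rw [div_self (hg b).ne'] at h
      linarith
    · exact (hctrl b c hbc).trans ((hmono.monotoneOn (div_pos (hg c) (hg b)).le hδ₀
        (h.trans (min_le_left _ _))).trans hθδ₀.le)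
  have ht : 0 < g c / g b := div_pos (hg c) (hg b)
  have hone : (1 : ℝ) ≤ 2 / l := by
    rw [one_le_div hl]
    linarith
  rcases le_total 1 (g c / g b) with h1 | h1
  · obtain ⟨n, hn1, hn2⟩ := exists_nat_pow_near h1 one_lt_two
    have hA2 : A = (2 : ℝ) ^ p := (Real.rpow_logb two_pos (by norm_num) hA0).symm
    have hp : 0 ≤ p := Real.logb_nonneg one_lt_two hA
    have hAn : A ^ n ≤ (g c / g b) ^ β := by
      calc A ^ n = ((2 : ℝ) ^ n) ^ p := by
            rw [hA2, ← Real.rpow_natCast, ← Real.rpow_natCast, ← Real.rpow_mul two_pos.le,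
              ← Real.rpow_mul two_pos.le, mul_comm]
        _ ≤ (g c / g b) ^ p := Real.rpow_le_rpow (by positivity) hn1 hp
        _ ≤ (g c / g b) ^ β := Real.rpow_le_rpow_of_exponent_le h1 hpβ
    calc G c / G b ≤ A ^ (n + 1 + 1) :=
          div_le_pow_of_le_two_pow hl hA hg hG hd hstepA hl1 (n + 1) b c hn2.le
      _ = A ^ 2 * A ^ n := by ring
      _ ≤ 2 * A ^ 2 * (g c / g b) ^ β := by
          refine mul_le_mul ?_ hAn (by positivity) (by positivity)
          nlinarith [sq_nonneg A]
      _ ≤ _ := by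
          gcongr
          exact le_max_right _ _
  · obtain ⟨n, hn1, hn2⟩ := exists_nat_pow_near_of_lt_one ht h1 hε hε1
    have hq2 : (1 / 2 : ℝ) = ε ^ q := (Real.rpow_logb hε hε1.ne (by norm_num)).symm
    have hqn : (1 / 2 : ℝ) ^ (n + 1) ≤ (g c / g b) ^ (1 / β) := by
      calc (1 / 2 : ℝ) ^ (n + 1) = (ε ^ (n + 1)) ^ q := by
            rw [hq2, ← Real.rpow_natCast, ← Real.rpow_natCast, ← Real.rpow_mul hε.le,
              ← Real.rpow_mul hε.le, mul_comm]
        _ ≤ (g c / g b) ^ q := Real.rpow_le_rpow (by positivity) hn1.le hq.le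
        _ ≤ (g c / g b) ^ (1 / β) := Real.rpow_le_rpow_of_exponent_ge ht h1 hβq
    calc G c / G b ≤ A * (1 / 2) ^ n :=
          div_le_mul_half_pow hδ hA0.le hg hG hd (fun b c h => hstepA b c (h.trans hone))
            hstepδ hl n b c hn2
      _ = 2 * A * (1 / 2) ^ (n + 1) := by ring
      _ ≤ 2 * A ^ 2 * (g c / g b) ^ (1 / β) := by
          refine mul_le_mul ?_ hqn (by positivity) (by positivity)
          nlinarith
      _ ≤ _ := by
          gcongr
          exact le_max_left _ _

/-- on a uniformly perfect quasi-metric space with no isolated points,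
every quasimöbius bijection is power quasimöbius, quantitatively. -/
theorem stmt9 (K K' μ : ℝ) (θ : ℝ → ℝ) (hK : 1 ≤ K) (hK' : 1 ≤ K')
    (hμ0 : 0 < μ) (hμ1 : μ < 1) (hθ : ControlFun θ) :
    ∃ β M : ℝ, 1 ≤ β ∧ 1 ≤ M ∧
      ∀ {Z : Type u} {Z₂ : Type v} (ρ : Z → Z → ℝ) (ρ₂ : Z₂ → Z₂ → ℝ) (f : Z → Z₂),
        IsQuasiMetric K ρ → IsQuasiMetric K' ρ₂ → UniformlyPerfectWith ρ μ →
        NoIsolatedPoints ρ → Function.Bijective f → QuasiMobius ρ ρ₂ f θ →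
        QuasiMobius ρ ρ₂ f (fun t => M * max (t ^ (1 / β)) (t ^ β)) := by
  have hk : 0 < μ / K ^ 2 := by positivity
  have hk1 : μ / K ^ 2 ≤ 1 := div_le_one_of_le₀ (by nlinarith) (by positivity)
  obtain ⟨β, M, hβ, hM, h⟩ :=
    exists_power_control.{u} hθ (pow_pos hk 2) (pow_le_one₀ hk.le hk1)
  refine ⟨β, M, hβ, hM, ?_⟩
  intro Z Z₂ ρ ρ₂ f hρ hρ₂ hup _ hf hqm a b c d hab hac had hbc hbd hcd
  simp only [crossRatio_eq_div_div]
  refine h (S := {x // x ≠ a ∧ x ≠ d}) (fun x => ρ a x / ρ x d)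
    (fun x => ρ₂ (f a) (f x) / ρ₂ (f x) (f d)) ?_ ?_ ?_ ?_ ⟨b, hab.symm, hbd⟩ ⟨c, hac.symm, hcd⟩
  · rintro ⟨x, hxa, hxd⟩
    exact div_pos (hρ.pos hxa.symm) (hρ.pos hxd)
  · rintro ⟨x, hxa, hxd⟩
    exact div_pos (hρ₂.pos (hf.1.ne hxa.symm)) (hρ₂.pos (hf.1.ne hxd))
  · intro s hs
    obtain ⟨x, hxa, hxd, hx⟩ := hup.exists_ratio hK hμ0 hμ1.le hρ had hs
    exact ⟨⟨x, hxa, hxd⟩, hx⟩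
  · rintro ⟨x, hxa, hxd⟩ ⟨y, hya, hyd⟩ hxy
    simpa only [crossRatio_eq_div_div] using
      hqm a x y d hxa.symm hya.symm had (fun e => hxy (Subtype.ext e)) hxd hyd
end

section
/- Let f : (Z₁,ρ₁) → (Z₂,ρ₂) be an η-quasisymmetric bijection between K-quasi-metric spaces. Then f is θ-quasimöbius with θ(t) = 1/θ_K⁻¹(1/η(θ_K(t))), where θ_K(t) = K²·max(t, √t) and θ_K⁻¹ is its inverse on [0,∞). -/
open Filter Topology

universe u v

/-- `θ_K(t) = K²·max(t, √t)`. -/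
noncomputable def thetaK (K t : ℝ) : ℝ := K ^ 2 * max t (Real.sqrt t)

/-- The inverse of `θ_K` on `[0,∞)`. -/
noncomputable def thetaKInv (K s : ℝ) : ℝ := sInf {t : ℝ | 0 ≤ t ∧ s ≤ thetaK K t}

/-- A quadrilateral with sides `u ≤ v` and `p`, `q`: if `v ≤ K² max(p, q, u)`, then
`min p q / u` is controlled by the cross ratio. -/
theorem min_le_thetaK_mul_of_le {K p q u v : ℝ} (hK : 1 ≤ K) (hp : 0 < p) (hq : 0 < q)
    (hu : 0 < u) (hv : 0 < v) (h : v ≤ K ^ 2 * max (max p q) u) :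
    min p q ≤ thetaK K (p * q / (u * v)) * u := by
  have hmM : min p q * max p q = p * q := min_mul_max p q
  have hm : 0 < min p q := lt_min hp hq
  have hm_le : min p q ≤ max p q := min_le_max
  unfold thetaK
  rw [← hmM]
  generalize min p q = m at *
  generalize max p q = M at *
  have hM : 0 < M := hm.trans_le hm_le
  rcases le_total u M with huM | hMu
  · rw [max_eq_left huM] at h
    calc m ≤ K ^ 2 * (m * M / (u * v)) * u := by
          have e : K ^ 2 * (m * M / (u * v)) * u = m * (K ^ 2 * M) / v := by
            field_simp
          rw [e, le_div_iff₀ hv]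
          gcongr
      _ ≤ _ := by gcongr; exact le_max_left _ _
  · rw [max_eq_right hMu] at h
    have hr : (m / (K ^ 2 * u)) ≤ √(m * M / (u * v)) := by
      apply Real.le_sqrt_of_sq_le
      rw [div_pow, div_le_div_iff₀ (by positivity) (by positivity)]
      have hK2 : 1 ≤ K ^ 2 := one_le_pow₀ hK
      calc m ^ 2 * (u * v) ≤ (m * M) * (u * (K ^ 2 * u)) := by
            rw [sq]
            gcongr
        _ ≤ (m * M) * (u * (K ^ 2 * u)) * K ^ 2 := le_mul_of_one_le_right (by positivity) hK2
        _ = m * M * (K ^ 2 * u) ^ 2 := by ring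
    calc m = K ^ 2 * (m / (K ^ 2 * u)) * u := by field_simp
      _ ≤ K ^ 2 * max (m * M / (u * v)) (√(m * M / (u * v))) * u := by
          gcongr
          exact hr.trans (le_max_right _ _)

theorem IsQuasiMetric.le_sq_mul_max {Z : Type*} {K : ℝ} {ρ : Z → Z → ℝ} (hK : 1 ≤ K)
    (h : IsQuasiMetric K ρ) (w x y z : Z) :
    ρ w z ≤ K ^ 2 * max (max (ρ w x) (ρ y z)) (ρ x y) := by
  obtain ⟨hnn, -, -, htri⟩ := h
  have hK0 : 0 ≤ K := by linarith
  have h1 := htri w x z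
  have h2 := htri x y z
  have hwx := hnn w x
  set B := max (max (ρ w x) (ρ y z)) (ρ x y)
  have hB1 : ρ w x ≤ B := (le_max_left _ _).trans (le_max_left _ _)
  have hB2 : max (ρ x y) (ρ y z) ≤ B :=
    max_le (le_max_right _ _) ((le_max_right _ _).trans (le_max_left _ _))
  have hxz : ρ x z ≤ K * B := h2.trans (by gcongr)
  have hBK : B ≤ K * B := le_mul_of_one_le_left (hwx.trans hB1) hK
  calc ρ w z ≤ K * max (ρ w x) (ρ x z) := h1
    _ ≤ K * (K * B) := by
        gcongr
        exact max_le (hB1.trans hBK) hxz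
    _ = K ^ 2 * B := by ring

theorem IsQuasiMetric.min_le_thetaK_crossRatio {Z : Type*} {K : ℝ} {ρ : Z → Z → ℝ}
    (hK : 1 ≤ K) (h : IsQuasiMetric K ρ) {a b c d : Z} (hab : a ≠ b) (hac : a ≠ c)
    (hbd : b ≠ d) (hcd : c ≠ d) :
    min (ρ a c) (ρ b d) ≤ thetaK K (crossRatio ρ a b c d) * min (ρ a b) (ρ c d) := by
  have hsymm := h.2.2.1
  unfold crossRatio
  rcases le_total (ρ a b) (ρ c d) with hle | hle
  · rw [min_eq_left hle]
    refine min_le_thetaK_mul_of_le hK (h.pos hac) (h.pos hbd) (h.pos hab) (h.pos hcd) ?_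
    rw [hsymm a c]
    exact h.le_sq_mul_max hK c a b d
  · rw [min_eq_right hle, mul_comm (ρ a b)]
    refine min_le_thetaK_mul_of_le hK (h.pos hac) (h.pos hbd) (h.pos hcd) (h.pos hab) ?_
    rw [hsymm b d]
    exact h.le_sq_mul_max hK a c d b

theorem thetaK_pos {K t : ℝ} (hK : 1 ≤ K) (ht : 0 < t) : 0 < thetaK K t := by
  have : 0 < max t (√t) := lt_max_of_lt_left ht
  unfold thetaK
  positivity

theorem ControlFun.pos {η : ℝ → ℝ} (hη : ControlFun η) {t : ℝ} (ht : 0 < t) : 0 < η t := by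
  rw [← hη.1]
  exact hη.2.1 Set.self_mem_Ici ht.le ht

theorem thetaKInv_pos {K s : ℝ} (hK : 1 ≤ K) (hs : 0 < s) : 0 < thetaKInv K s := by
  have hK0 : 0 < K ^ 2 := by positivity
  have hx : 0 < s / K ^ 2 := by positivity
  refine lt_of_lt_of_le (lt_min hx (pow_pos hx 2)) (le_csInf ⟨s, hs.le, ?_⟩ ?_)
  · unfold thetaK
    calc s ≤ K ^ 2 * s := le_mul_of_one_le_left hs.le (one_le_pow₀ hK)
      _ ≤ _ := by gcongr; exact le_max_left _ _
  · rintro t ⟨ht, hst⟩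
    have h : s / K ^ 2 ≤ max t (√t) := by
      rw [div_le_iff₀' hK0]
      exact hst
    rcases le_max_iff.1 h with h | h
    · exact (min_le_left _ _).trans h
    · exact (min_le_right _ _).trans ((Real.le_sqrt' hx).1 h)

theorem thetaKInv_le {K s t : ℝ} (ht : 0 ≤ t) (hst : s ≤ thetaK K t) : thetaKInv K s ≤ t :=
  csInf_le ⟨0, fun _ hx => hx.1⟩ ⟨ht, hst⟩

theorem QuasiSymmetric.min_le_mul {Z₁ Z₂ : Type*} {K : ℝ} {ρ₁ : Z₁ → Z₁ → ℝ}
    {ρ₂ : Z₂ → Z₂ → ℝ} (hρ₁ : IsQuasiMetric K ρ₁) (hρ₂ : IsQuasiMetric K ρ₂) {f : Z₁ → Z₂}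
    {η : ℝ → ℝ} (hqs : QuasiSymmetric ρ₁ ρ₂ f η) {a b c d : Z₁} (hab : a ≠ b) {t : ℝ}
    (ht : 0 ≤ t) (h : min (ρ₁ a c) (ρ₁ b d) ≤ t * ρ₁ a b) :
    min (ρ₂ (f a) (f c)) (ρ₂ (f b) (f d)) ≤ η t * ρ₂ (f a) (f b) := by
  rcases min_le_iff.1 h with h | h
  · exact (min_le_left _ _).trans (hqs a c b hab t ht h)
  · rw [hρ₁.2.2.1 a b] at h
    rw [hρ₂.2.2.1 (f a) (f b)]
    exact (min_le_right _ _).trans (hqs b d a hab.symm t ht h)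

/-- an `η`-quasisymmetric bijection between `K`-quasi-metric spaces is
`θ`-quasimöbius with `θ(t) = 1/θ_K⁻¹(1/η(θ_K(t)))`. -/
theorem stmt12 {Z₁ : Type u} {Z₂ : Type v} (K : ℝ) (hK : 1 ≤ K)
    (ρ₁ : Z₁ → Z₁ → ℝ) (ρ₂ : Z₂ → Z₂ → ℝ)
    (hρ₁ : IsQuasiMetric K ρ₁) (hρ₂ : IsQuasiMetric K ρ₂)
    (f : Z₁ → Z₂) (hbij : Function.Bijective f) (η : ℝ → ℝ) (hη : ControlFun η)
    (hqs : QuasiSymmetric ρ₁ ρ₂ f η) :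
    QuasiMobius ρ₁ ρ₂ f (fun t => 1 / thetaKInv K (1 / η (thetaK K t))) := by
  intro a b c d hab hac _ _ hbd hcd
  have hf := hbij.injective
  have hr : 0 < crossRatio ρ₁ a b c d :=
    div_pos (mul_pos (hρ₁.pos hac) (hρ₁.pos hbd)) (mul_pos (hρ₁.pos hab) (hρ₁.pos hcd))
  have hT := thetaK_pos hK hr
  have hsource := hρ₁.min_le_thetaK_crossRatio hK hab hac hbd hcd
  set T := thetaK K (crossRatio ρ₁ a b c d) with hTdef
  have hηT := hη.pos hT
  have hab' := hρ₂.pos (hf.ne hab)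
  have hac' := hρ₂.pos (hf.ne hac)
  have hbd' := hρ₂.pos (hf.ne hbd)
  have hcd' := hρ₂.pos (hf.ne hcd)
  have himage : min (ρ₂ (f a) (f c)) (ρ₂ (f b) (f d)) ≤
      η T * min (ρ₂ (f a) (f b)) (ρ₂ (f c) (f d)) := by
    rw [mul_min_of_nonneg _ _ hηT.le]
    refine le_min (hqs.min_le_mul hρ₁ hρ₂ hab hT.le ?_) ?_
    · exact hsource.trans (mul_le_mul_of_nonneg_left (min_le_left _ _) hT.le)
    · rw [hρ₂.2.2.1 (f a) (f c), hρ₂.2.2.1 (f b) (f d)]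
      refine hqs.min_le_mul hρ₁ hρ₂ hcd hT.le ?_
      rw [hρ₁.2.2.1 c a, hρ₁.2.2.1 d b]
      exact hsource.trans (mul_le_mul_of_nonneg_left (min_le_right _ _) hT.le)
  have hswap := hρ₂.min_le_thetaK_crossRatio hK (hf.ne hac) (hf.ne hab) (hf.ne hcd) (hf.ne hbd)
  have hr' : 0 < crossRatio ρ₂ (f a) (f c) (f b) (f d) :=
    div_pos (mul_pos hab' hcd') (mul_pos hac' hbd')
  have hinv : crossRatio ρ₂ (f a) (f b) (f c) (f d) =
      1 / crossRatio ρ₂ (f a) (f c) (f b) (f d) := by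
    simp only [crossRatio, one_div_div]
  have hlower : 1 / η T ≤ thetaK K (crossRatio ρ₂ (f a) (f c) (f b) (f d)) := by
    rw [div_le_iff₀ hηT]
    have hn := lt_min hab' hcd'
    refine le_of_mul_le_mul_right ?_ hn
    calc 1 * min (ρ₂ (f a) (f b)) (ρ₂ (f c) (f d)) ≤ _ := by rw [one_mul]; exact hswap
      _ ≤ _ := mul_le_mul_of_nonneg_left himage (thetaK_pos hK hr').le
      _ = _ := by ring
  rw [hinv]
  exact one_div_le_one_div_of_le (thetaKInv_pos hK (one_div_pos.2 hηT))
    (thetaKInv_le hr'.le hlower)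
end

section
/- Let f : (Z₁,ρ₁) → (Z₂,ρ₂) be a power quasisymmetric bijection between K-quasi-metric spaces with control function η(t) = M·max(t^α, t^{1/α}), where M ≥ 1 and α ≥ 1. Then f is power quasimöbius with control function θ(t) = M²·K^{4(1+α)}·max(t^{2α}, t^{1/(2α)}). -/
open Filter Topology

universe u v

/-- `t ↦ max (t ^ (2 * α)) (t ^ (1 / (2 * α)))` dominates every power of `t` whose exponent lies
between `1 / (2 * α)` and `2 * α`. -/
theorem rpow_le_max_rpow_two_mul {α β t : ℝ} (ht : 0 < t) (h₁ : 1 / (2 * α) ≤ β)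
    (h₂ : β ≤ 2 * α) : t ^ β ≤ max (t ^ (2 * α)) (t ^ (1 / (2 * α))) := by
  rcases le_total 1 t with h | h
  · exact le_max_of_le_left (Real.rpow_le_rpow_of_exponent_le h h₂)
  · exact le_max_of_le_right (Real.rpow_le_rpow_of_exponent_ge ht h h₁)

theorem max_rpow_of_one_le {α t : ℝ} (hα : 1 ≤ α) (ht : 1 ≤ t) :
    max (t ^ α) (t ^ (1 / α)) = t ^ α :=
  max_eq_left (Real.rpow_le_rpow_of_exponent_le ht
    (((div_le_one (by linarith)).2 hα).trans hα))

theorem max_rpow_of_le_one {α t : ℝ} (hα : 1 ≤ α) (h0 : 0 < t) (ht : t ≤ 1) :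
    max (t ^ α) (t ^ (1 / α)) = t ^ (1 / α) :=
  max_eq_right (Real.rpow_le_rpow_of_exponent_ge h0 ht
    (((div_le_one (by linarith)).2 hα).trans hα))

/-- The product of two power controls is bounded by a power control of the product, as long as
the arguments do not lie far apart on different sides of `1`. -/
theorem max_rpow_mul_max_rpow_le {K α s u : ℝ} (hK : 1 ≤ K) (hα : 1 ≤ α) (hs : 0 < s)
    (hu : 0 < u) (h₁ : 1 ≤ s → u ≤ 1 → 1 ≤ K ^ 2 * u) (h₂ : s ≤ 1 → 1 ≤ u → u ≤ K ^ 2) :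
    max (s ^ α) (s ^ (1 / α)) * max (u ^ α) (u ^ (1 / α)) ≤
      K ^ (4 * (1 + α)) * max ((s * u) ^ (2 * α)) ((s * u) ^ (1 / (2 * α))) := by
  have hα0 : 0 < α := by linarith
  have hsu : 0 < s * u := mul_pos hs hu
  have hinv : 1 / (2 * α) ≤ 1 / α := one_div_le_one_div_of_le hα0 (by linarith)
  have hinv1 : 1 / α ≤ 1 := (div_le_one hα0).2 hα
  have hinv0 : 0 ≤ 1 / α := by positivity
  have hKα : (K ^ 2) ^ α ≤ K ^ (4 * (1 + α)) := by
    rw [← Real.rpow_natCast_mul (by linarith)]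
    exact Real.rpow_le_rpow_of_exponent_le hK (by push_cast; linarith)
  have hK1 : 1 ≤ K ^ (4 * (1 + α)) := Real.one_le_rpow hK (by linarith)
  have hmα := rpow_le_max_rpow_two_mul hsu (α := α) (β := α) (by linarith) (by linarith)
  have hmi := rpow_le_max_rpow_two_mul hsu (α := α) (β := 1 / α) hinv (by linarith)
  have hpos : 0 < max ((s * u) ^ (2 * α)) ((s * u) ^ (1 / (2 * α))) :=
    lt_max_of_lt_left (Real.rpow_pos_of_pos hsu _)
  rcases le_total 1 s with hs1 | hs1 <;> rcases le_total 1 u with hu1 | hu1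
  · rw [max_rpow_of_one_le hα hs1, max_rpow_of_one_le hα hu1, ← Real.mul_rpow hs.le hu.le]
    exact hmα.trans (le_mul_of_one_le_left hpos.le hK1)
  · rw [max_rpow_of_one_le hα hs1, max_rpow_of_le_one hα hu hu1]
    have hsK : s ≤ K ^ 2 * (s * u) := by nlinarith [h₁ hs1 hu1]
    calc s ^ α * u ^ (1 / α) ≤ s ^ α :=
          mul_le_of_le_one_right (by positivity) (Real.rpow_le_one hu.le hu1 hinv0)
      _ ≤ (K ^ 2 * (s * u)) ^ α := Real.rpow_le_rpow hs.le hsK hα0.le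
      _ = (K ^ 2) ^ α * (s * u) ^ α := Real.mul_rpow (by positivity) hsu.le
      _ ≤ _ := by gcongr
  · rw [max_rpow_of_le_one hα hs hs1, max_rpow_of_one_le hα hu1]
    calc s ^ (1 / α) * u ^ α ≤ (s * u) ^ (1 / α) * (K ^ 2) ^ α := by
          gcongr
          · exact le_mul_of_one_le_right hs.le hu1
          · exact h₂ hs1 hu1
      _ = (K ^ 2) ^ α * (s * u) ^ (1 / α) := mul_comm _ _
      _ ≤ _ := by gcongr
  · rw [max_rpow_of_le_one hα hs hs1, max_rpow_of_le_one hα hu hu1,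
      ← Real.mul_rpow hs.le hu.le]
    exact hmi.trans (le_mul_of_one_le_left hpos.le hK1)

theorem IsQuasiMetric.le_sq_mul {Z : Type*} {K : ℝ} {ρ : Z → Z → ℝ} (h : IsQuasiMetric K ρ)
    (hK : 1 ≤ K) {w x y z : Z} {m : ℝ} (hwx : ρ w x ≤ m) (hxy : ρ x y ≤ m) (hyz : ρ y z ≤ m) :
    ρ w z ≤ K ^ 2 * m := by
  have hm : 0 ≤ m := (h.1 w x).trans hwx
  have hwy : ρ w y ≤ K * m :=
    (h.2.2.2 w x y).trans (mul_le_mul_of_nonneg_left (max_le hwx hxy) (by linarith))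
  calc ρ w z ≤ K * max (ρ w y) (ρ y z) := h.2.2.2 w y z
    _ ≤ K * (K * m) := mul_le_mul_of_nonneg_left
        (max_le hwy (hyz.trans (le_mul_of_one_le_left hm hK))) (by linarith)
    _ = K ^ 2 * m := by ring

theorem IsQuasiMetric.crossRatio_swap_pairs {Z : Type*} {K : ℝ} {ρ : Z → Z → ℝ}
    (h : IsQuasiMetric K ρ) (a b c d : Z) : crossRatio ρ c d a b = crossRatio ρ a b c d := by
  unfold crossRatio
  rw [h.2.2.1 c a, h.2.2.1 d b, mul_comm (ρ c d)]

theorem IsQuasiMetric.crossRatio_swap_within {Z : Type*} {K : ℝ} {ρ : Z → Z → ℝ}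
    (h : IsQuasiMetric K ρ) (a b c d : Z) : crossRatio ρ b a d c = crossRatio ρ a b c d := by
  unfold crossRatio
  rw [h.2.2.1 b a, h.2.2.1 d c, mul_comm (ρ b d)]

/-- The quasimöbius estimate for quadruples whose smaller cross ratio factors are `ρ₁ a b` and
`ρ₁ a c`. -/
theorem QuasiSymmetric.crossRatio_le {Z₁ Z₂ : Type*} {K M α : ℝ} (hK : 1 ≤ K) (hM : 1 ≤ M)
    (hα : 1 ≤ α) {ρ₁ : Z₁ → Z₁ → ℝ} {ρ₂ : Z₂ → Z₂ → ℝ} (hρ₁ : IsQuasiMetric K ρ₁)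
    (hρ₂ : IsQuasiMetric K ρ₂) {f : Z₁ → Z₂} (hf : Function.Injective f)
    (hqs : QuasiSymmetric ρ₁ ρ₂ f (fun t => M * max (t ^ α) (t ^ (1 / α))))
    {a b c d : Z₁} (hab : a ≠ b) (hac : a ≠ c) (hbd : b ≠ d) (hcd : c ≠ d)
    (hden : ρ₁ a b ≤ ρ₁ c d) (hnum : ρ₁ a c ≤ ρ₁ b d) :
    crossRatio ρ₂ (f a) (f b) (f c) (f d) ≤ M ^ 2 * K ^ (4 * (1 + α)) *
      max (crossRatio ρ₁ a b c d ^ (2 * α)) (crossRatio ρ₁ a b c d ^ (1 / (2 * α))) := by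
  have pab := hρ₁.pos hab
  have pac := hρ₁.pos hac
  have pbd := hρ₁.pos hbd
  have pcd := hρ₁.pos hcd
  have symm₁ := hρ₁.2.2.1
  have hr : crossRatio ρ₁ a b c d = ρ₁ a c / ρ₁ a b * (ρ₁ b d / ρ₁ c d) :=
    mul_div_mul_comm _ _ _ _
  have hs : ρ₂ (f a) (f c) / ρ₂ (f a) (f b) ≤
      M * max ((ρ₁ a c / ρ₁ a b) ^ α) ((ρ₁ a c / ρ₁ a b) ^ (1 / α)) :=
    (div_le_iff₀ (hρ₂.pos (hf.ne hab))).2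
      (hqs a c b hab _ (by positivity) (div_mul_cancel₀ _ pab.ne').ge)
  have hu : ρ₂ (f b) (f d) / ρ₂ (f c) (f d) ≤
      M * max ((ρ₁ b d / ρ₁ c d) ^ α) ((ρ₁ b d / ρ₁ c d) ^ (1 / α)) := by
    rw [div_le_iff₀ (hρ₂.pos (hf.ne hcd)), hρ₂.2.2.1 (f b), hρ₂.2.2.1 (f c)]
    refine hqs d b c hcd.symm _ (by positivity) ?_
    rw [symm₁ d b, symm₁ d c, div_mul_cancel₀ _ pcd.ne']
  have hmain := max_rpow_mul_max_rpow_le (s := ρ₁ a c / ρ₁ a b) (u := ρ₁ b d / ρ₁ c d) hK hα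
    (by positivity) (by positivity)
    (fun h _ => by
      rw [one_le_div pab] at h
      rw [← mul_div_assoc, one_le_div pcd]
      exact hρ₁.le_sq_mul hK (x := a) (y := b) (by rwa [symm₁]) (h.trans hnum) le_rfl)
    (fun h _ => by
      rw [div_le_one pab] at h
      rw [div_le_iff₀ pcd]
      exact hρ₁.le_sq_mul hK (x := a) (y := c) (by rwa [symm₁]) (h.trans hden) le_rfl)
  rw [hr]
  calc crossRatio ρ₂ (f a) (f b) (f c) (f d)
      = ρ₂ (f a) (f c) / ρ₂ (f a) (f b) * (ρ₂ (f b) (f d) / ρ₂ (f c) (f d)) :=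
        mul_div_mul_comm _ _ _ _
    _ ≤ _ := mul_le_mul hs hu (div_nonneg (hρ₂.1 _ _) (hρ₂.1 _ _)) (by positivity)
    _ = M ^ 2 * (max ((ρ₁ a c / ρ₁ a b) ^ α) ((ρ₁ a c / ρ₁ a b) ^ (1 / α)) *
          max ((ρ₁ b d / ρ₁ c d) ^ α) ((ρ₁ b d / ρ₁ c d) ^ (1 / α))) := by ring
    _ ≤ _ := mul_le_mul_of_nonneg_left hmain (by positivity)
    _ = _ := by ring

/-- a power quasisymmetric bijection with control
`η(t) = M·max(t^α, t^{1/α})` is power quasimöbius with control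
`θ(t) = M²·K^{4(1+α)}·max(t^{2α}, t^{1/(2α)})`. -/
theorem stmt13 {Z₁ : Type u} {Z₂ : Type v} (K M α : ℝ)
    (hK : 1 ≤ K) (hM : 1 ≤ M) (hα : 1 ≤ α)
    (ρ₁ : Z₁ → Z₁ → ℝ) (ρ₂ : Z₂ → Z₂ → ℝ)
    (hρ₁ : IsQuasiMetric K ρ₁) (hρ₂ : IsQuasiMetric K ρ₂)
    (f : Z₁ → Z₂) (hbij : Function.Bijective f)
    (hqs : QuasiSymmetric ρ₁ ρ₂ f (fun t => M * max (t ^ α) (t ^ (1 / α)))) :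
    QuasiMobius ρ₁ ρ₂ f
      (fun t => M ^ 2 * K ^ (4 * (1 + α)) * max (t ^ (2 * α)) (t ^ (1 / (2 * α)))) := by
  intro a b c d hab hac _ _ hbd hcd
  beta_reduce
  rcases le_total (ρ₁ a b) (ρ₁ c d) with hden | hden <;>
    rcases le_total (ρ₁ a c) (ρ₁ b d) with hnum | hnum
  · exact hqs.crossRatio_le hK hM hα hρ₁ hρ₂ hbij.1 hab hac hbd hcd hden hnum
  · rw [← hρ₁.crossRatio_swap_within, ← hρ₂.crossRatio_swap_within]
    exact hqs.crossRatio_le hK hM hα hρ₁ hρ₂ hbij.1 hab.symm hbd hac hcd.symm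
      (by rwa [hρ₁.2.2.1 b, hρ₁.2.2.1 d]) hnum
  · rw [← hρ₁.crossRatio_swap_pairs, ← hρ₂.crossRatio_swap_pairs]
    exact hqs.crossRatio_le hK hM hα hρ₁ hρ₂ hbij.1 hcd hac.symm hbd.symm hab hden
      (by rwa [hρ₁.2.2.1 c, hρ₁.2.2.1 d])
  · rw [← hρ₁.crossRatio_swap_pairs, ← hρ₂.crossRatio_swap_pairs,
      ← hρ₁.crossRatio_swap_within, ← hρ₂.crossRatio_swap_within]
    exact hqs.crossRatio_le hK hM hα hρ₁ hρ₂ hbij.1 hcd.symm hbd.symm hac.symm hab.symm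
      (by rwa [hρ₁.2.2.1 d, hρ₁.2.2.1 b]) (by rwa [hρ₁.2.2.1 c, hρ₁.2.2.1 d])
end

section
/- Let (Z₁,ρ₁) and (Z₂,ρ₂) be bounded K-quasi-metric spaces of positive diameter, and let f : Z₁ → Z₂ be a θ-quasimöbius bijection with θ(t) = M·max(t^{1/β}, t^β) for constants M ≥ 1, β ≥ 1, which satisfies the λ-three-point condition for some λ ≥ 1. Then f is η-quasisymmetric with η(t) = K^{3+6β}·M·(2λ)^{1+2β}·max(t^{1/(2β)}, t^{2β}); in particular, f is power quasisymmetric. -/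
open Filter Topology

universe u v

/-- The diameter of a quasi-metric space, `sup ρ`. -/
noncomputable def qdiam {Z : Type*} (ρ : Z → Z → ℝ) : ℝ :=
  sSup (Set.range fun p : Z × Z => ρ p.1 p.2)

theorem IsQuasiMetric.pos_of_ne {Z : Type*} {K : ℝ} {ρ : Z → Z → ℝ}
    (hρ : IsQuasiMetric K ρ) {x y : Z} (h : x ≠ y) : 0 < ρ x y :=
  lt_of_le_of_ne (hρ.1 x y) fun e => h ((hρ.2.1 x y).1 e.symm)

/-- A point cannot be close to both of two points which are far apart. -/
theorem IsQuasiMetric.far_from_one {Z : Type*} {K lam d : ℝ} {ρ : Z → Z → ℝ}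
    (hρ : IsQuasiMetric K ρ) (hlam : 0 < lam) {p q : Z} (h : d / lam ≤ ρ p q) (w : Z) :
    d ≤ lam * K * ρ w p ∨ d ≤ lam * K * ρ w q := by
  have h1 := (div_le_iff₀ hlam).1 (h.trans (hρ.2.2.2 p w q))
  rw [hρ.2.2.1 p w] at h1
  rcases le_total (ρ w p) (ρ w q) with h2 | h2
  · rw [max_eq_right h2] at h1
    exact Or.inr (by linarith)
  · rw [max_eq_left h2] at h1
    exact Or.inl (by linarith)

theorem le_qdiam {Z : Type*} {ρ : Z → Z → ℝ} (h : ∃ D : ℝ, ∀ x y : Z, ρ x y ≤ D) (x y : Z) :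
    ρ x y ≤ qdiam ρ := by
  obtain ⟨D, hD⟩ := h
  exact le_csSup ⟨D, by rintro _ ⟨p, rfl⟩; exact hD _ _⟩ ⟨(x, y), rfl⟩

theorem Real.rpow_le_max_rpow {t p q s : ℝ} (ht : 0 < t) (hpq : p ≤ q) (hqs : q ≤ s) :
    t ^ q ≤ max (t ^ p) (t ^ s) := by
  rcases le_total t 1 with h | h
  · exact (Real.rpow_le_rpow_of_exponent_ge ht h hpq).trans (le_max_left _ _)
  · exact (Real.rpow_le_rpow_of_exponent_le h hqs).trans (le_max_right _ _)

theorem max_rpow_le_mul_max_rpow {β L t r : ℝ} (hβ : 1 ≤ β) (hL : 1 ≤ L) (ht : 0 < t)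
    (hr : 0 ≤ r) (hrt : r ≤ L * t) :
    max (r ^ (1 / β)) (r ^ β) ≤ L ^ β * max (t ^ (1 / (2 * β))) (t ^ (2 * β)) := by
  have hβ0 : 0 < β := by linarith
  have hinv : 1 / β ≤ 1 := (div_le_one hβ0).2 hβ
  have hinv0 : 0 < 1 / β := by positivity
  have hhalf : 1 / (2 * β) ≤ 1 / β := one_div_le_one_div_of_le hβ0 (by linarith)
  have key : ∀ p, 1 / β ≤ p → p ≤ β →
      r ^ p ≤ L ^ β * max (t ^ (1 / (2 * β))) (t ^ (2 * β)) := by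
    intro p hp hpβ
    calc r ^ p ≤ (L * t) ^ p := Real.rpow_le_rpow hr hrt (by linarith)
      _ = L ^ p * t ^ p := Real.mul_rpow (by linarith) ht.le
      _ ≤ L ^ β * max (t ^ (1 / (2 * β))) (t ^ (2 * β)) :=
        mul_le_mul (Real.rpow_le_rpow_of_exponent_le hL hpβ)
          (Real.rpow_le_max_rpow ht (by linarith) (by linarith)) (by positivity) (by positivity)
  exact max_le (key _ le_rfl (by linarith)) (key _ (by linarith) le_rfl)

theorem mul_rpow_mul_self_le {K β lam : ℝ} (hK : 1 ≤ K) (hβ : 1 ≤ β) (hlam : 1 ≤ lam) :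
    (lam * K) ^ β * (lam * K) ≤ K ^ (3 + 6 * β) * (2 * lam) ^ (1 + 2 * β) := by
  have hL : 0 < lam * K := by positivity
  calc (lam * K) ^ β * (lam * K) = (lam * K) ^ (β + 1) := by
        rw [Real.rpow_add hL, Real.rpow_one]
    _ = K ^ (β + 1) * lam ^ (β + 1) := by
        rw [Real.mul_rpow (by linarith) (by linarith), mul_comm]
    _ ≤ K ^ (3 + 6 * β) * (2 * lam) ^ (1 + 2 * β) := by
        refine mul_le_mul (Real.rpow_le_rpow_of_exponent_le hK (by linarith)) ?_
          (by positivity) (by positivity)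
        exact (Real.rpow_le_rpow_of_exponent_le hlam (by linarith)).trans
          (Real.rpow_le_rpow (by linarith) (by linarith) (by linarith))

/-- a power quasimöbius bijection between bounded quasi-metric spaces of
positive diameter satisfying the `λ`-three-point condition is power quasisymmetric, with
the explicit control function `η(t) = K^{3+6β}·M·(2λ)^{1+2β}·max(t^{1/(2β)}, t^{2β})`. -/
theorem stmt14 {Z₁ : Type u} {Z₂ : Type v} (K M β lam : ℝ)
    (hK : 1 ≤ K) (hM : 1 ≤ M) (hβ : 1 ≤ β) (hlam : 1 ≤ lam)
    (ρ₁ : Z₁ → Z₁ → ℝ) (ρ₂ : Z₂ → Z₂ → ℝ)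
    (hρ₁ : IsQuasiMetric K ρ₁) (hρ₂ : IsQuasiMetric K ρ₂)
    (hbdd₁ : ∃ D : ℝ, ∀ x y : Z₁, ρ₁ x y ≤ D) (hbdd₂ : ∃ D : ℝ, ∀ x y : Z₂, ρ₂ x y ≤ D)
    (hpos₁ : ∃ x y : Z₁, 0 < ρ₁ x y) (hpos₂ : ∃ x y : Z₂, 0 < ρ₂ x y)
    (f : Z₁ → Z₂) (hbij : Function.Bijective f)
    (hqm : QuasiMobius ρ₁ ρ₂ f (fun t => M * max (t ^ (1 / β)) (t ^ β)))
    (htp : ∃ z₁ z₂ z₃ : Z₁,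
      qdiam ρ₁ / lam ≤ ρ₁ z₁ z₂ ∧ qdiam ρ₁ / lam ≤ ρ₁ z₁ z₃ ∧ qdiam ρ₁ / lam ≤ ρ₁ z₂ z₃ ∧
      qdiam ρ₂ / lam ≤ ρ₂ (f z₁) (f z₂) ∧ qdiam ρ₂ / lam ≤ ρ₂ (f z₁) (f z₃) ∧
      qdiam ρ₂ / lam ≤ ρ₂ (f z₂) (f z₃)) :
    QuasiSymmetric ρ₁ ρ₂ f
      (fun t => K ^ (3 + 6 * β) * M * (2 * lam) ^ (1 + 2 * β) *
        max (t ^ (1 / (2 * β))) (t ^ (2 * β))) := by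
  obtain ⟨z₁, z₂, z₃, a₁, a₂, a₃, b₁, b₂, b₃⟩ := htp
  intro x a b hxb t ht hle
  have hx'b' : 0 < ρ₂ (f x) (f b) := hρ₂.pos_of_ne (hbij.1.ne hxb)
  have hlam0 : 0 < lam := by linarith
  have hL : 1 ≤ lam * K := one_le_mul_of_one_le_of_one_le hlam hK
  have hD₁ : 0 < qdiam ρ₁ := by
    obtain ⟨u, v, h⟩ := hpos₁
    exact h.trans_le (le_qdiam hbdd₁ u v)
  have hD₂ : 0 < qdiam ρ₂ := by
    obtain ⟨u, v, h⟩ := hpos₂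
    exact h.trans_le (le_qdiam hbdd₂ u v)
  rcases eq_or_ne x a with rfl | hxa
  · rw [(hρ₂.2.1 _ _).2 rfl]
    positivity
  have hxb₁ : 0 < ρ₁ x b := hρ₁.pos_of_ne hxb
  have hxa₁ : 0 < ρ₁ x a := hρ₁.pos_of_ne hxa
  have ht0 : 0 < t := pos_of_mul_pos_left (hxa₁.trans_le hle) hxb₁.le
  suffices H : ∃ r, 0 ≤ r ∧ r ≤ lam * K * t ∧ ρ₂ (f x) (f a) ≤
      M * max (r ^ (1 / β)) (r ^ β) * (lam * K) * ρ₂ (f x) (f b) by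
    obtain ⟨r, hr0, hr, h⟩ := H
    refine h.trans (mul_le_mul_of_nonneg_right ?_ hx'b'.le)
    calc M * max (r ^ (1 / β)) (r ^ β) * (lam * K)
        ≤ M * ((lam * K) ^ β * max (t ^ (1 / (2 * β))) (t ^ (2 * β))) * (lam * K) := by
          gcongr
          exact max_rpow_le_mul_max_rpow hβ hL ht0 hr0 hr
      _ = M * max (t ^ (1 / (2 * β))) (t ^ (2 * β)) * ((lam * K) ^ β * (lam * K)) := by ring
      _ ≤ M * max (t ^ (1 / (2 * β))) (t ^ (2 * β)) *
          (K ^ (3 + 6 * β) * (2 * lam) ^ (1 + 2 * β)) :=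
          mul_le_mul_of_nonneg_left (mul_rpow_mul_self_le hK hβ hlam) (by positivity)
      _ = _ := by ring
  have trivial_case : 1 ≤ lam * K * t → ρ₂ (f x) (f a) ≤ lam * K * ρ₂ (f x) (f b) →
      ∃ r, 0 ≤ r ∧ r ≤ lam * K * t ∧ ρ₂ (f x) (f a) ≤
        M * max (r ^ (1 / β)) (r ^ β) * (lam * K) * ρ₂ (f x) (f b) := by
    intro h1 h2
    refine ⟨1, zero_le_one, h1, h2.trans ?_⟩
    rw [Real.one_rpow, Real.one_rpow, max_self, mul_one]
    exact mul_le_mul_of_nonneg_right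
      (le_mul_of_one_le_left (zero_le_one.trans hL) hM) hx'b'.le
  rcases eq_or_ne a b with rfl | hab
  · have h1 : 1 ≤ t := le_of_mul_le_mul_right (by linarith) hxa₁
    exact trivial_case (one_le_mul_of_one_le_of_one_le hL h1)
      (le_mul_of_one_le_left hx'b'.le hL)
  obtain ⟨z, hz₁, hz₂⟩ : ∃ z, qdiam ρ₁ ≤ lam * K * ρ₁ a z ∧
      qdiam ρ₂ ≤ lam * K * ρ₂ (f b) (f z) := by
    by_contra! h
    have far : ∀ p q, qdiam ρ₁ / lam ≤ ρ₁ p q → qdiam ρ₂ / lam ≤ ρ₂ (f p) (f q) →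
        (qdiam ρ₁ ≤ lam * K * ρ₁ a p ∧ ¬ qdiam ρ₁ ≤ lam * K * ρ₁ a q) ∨
        (¬ qdiam ρ₁ ≤ lam * K * ρ₁ a p ∧ qdiam ρ₁ ≤ lam * K * ρ₁ a q) := by
      intro p q hpq hpq'
      rcases hρ₂.far_from_one hlam0 hpq' (f b) with h2 | h2
      · have h1 := fun k => (h p k).not_ge h2
        exact Or.inr ⟨h1, (hρ₁.far_from_one hlam0 hpq a).resolve_left h1⟩
      · have h1 := fun k => (h q k).not_ge h2
        exact Or.inl ⟨(hρ₁.far_from_one hlam0 hpq a).resolve_right h1, h1⟩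
    have c₁ := far _ _ a₁ b₁
    have c₂ := far _ _ a₂ b₂
    have c₃ := far _ _ a₃ b₃
    clear * - c₁ c₂ c₃
    tauto
  have haz : 0 < ρ₁ a z := pos_of_mul_pos_right (hD₁.trans_le hz₁) (by positivity)
  have hbz' : 0 < ρ₂ (f b) (f z) := pos_of_mul_pos_right (hD₂.trans_le hz₂) (by positivity)
  have haz_ne : a ≠ z := fun e => haz.ne' ((hρ₁.2.1 _ _).2 e)
  have hbz_ne : b ≠ z := fun e => hbz'.ne' ((hρ₂.2.1 _ _).2 (congrArg f e))
  have haz' : 0 < ρ₂ (f a) (f z) := hρ₂.pos_of_ne (hbij.1.ne haz_ne)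
  have hbz : 0 < ρ₁ b z := hρ₁.pos_of_ne hbz_ne
  rcases eq_or_ne x z with rfl | hxz
  · refine trivial_case (le_of_mul_le_mul_right ?_ hxb₁) ?_
    · calc 1 * ρ₁ x b ≤ qdiam ρ₁ := by rw [one_mul]; exact le_qdiam hbdd₁ _ _
        _ ≤ lam * K * ρ₁ x a := by rw [hρ₁.2.2.1 x a]; exact hz₁
        _ ≤ lam * K * (t * ρ₁ x b) := by gcongr
        _ = lam * K * t * ρ₁ x b := by ring
    · rw [hρ₂.2.2.1 (f x) (f b)]
      exact (le_qdiam hbdd₂ _ _).trans hz₂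
  · have hcr := hqm x b a z hxb hxa hxz hab.symm hbz_ne haz_ne
    refine ⟨crossRatio ρ₁ x b a z, by unfold crossRatio; positivity, ?_, ?_⟩
    · unfold crossRatio
      rw [div_le_iff₀ (by positivity)]
      calc ρ₁ x a * ρ₁ b z ≤ (t * ρ₁ x b) * (lam * K * ρ₁ a z) := by
            gcongr
            exact (le_qdiam hbdd₁ _ _).trans hz₁
        _ = _ := by ring
    · set T := M * max (crossRatio ρ₁ x b a z ^ (1 / β)) (crossRatio ρ₁ x b a z ^ β)
      have hT : crossRatio ρ₂ (f x) (f b) (f a) (f z) ≤ T := hcr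
      unfold crossRatio at hT
      have hT0 : 0 ≤ T := le_trans (div_nonneg (mul_nonneg (hρ₂.1 _ _) (hρ₂.1 _ _))
        (mul_nonneg (hρ₂.1 _ _) (hρ₂.1 _ _))) hT
      rw [div_le_iff₀ (by positivity)] at hT
      refine le_of_mul_le_mul_right ?_ hbz'
      calc ρ₂ (f x) (f a) * ρ₂ (f b) (f z) ≤ T * (ρ₂ (f x) (f b) * ρ₂ (f a) (f z)) := hT
        _ ≤ T * (ρ₂ (f x) (f b) * (lam * K * ρ₂ (f b) (f z))) := by
            gcongr
            exact (le_qdiam hbdd₂ _ _).trans hz₂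
        _ = _ := by ring
end

section
/- Let (Z₁,ρ₁) and (Z₂,ρ₂) be K-quasi-metric spaces and let f : Z₁ → Z₂ be an η-quasisymmetric bijection. If (Z₁,ρ₁) is (λ₁,λ₂)-HD, then (Z₂,ρ₂) is (μ₁,μ₂)-HD for constants 0 < μ₁ ≤ μ₂ < 1 depending only on λ₁, λ₂, η and K. -/
open Filter Topology

universe u v

/-- Homogeneous density can be iterated at a fixed base point. -/
theorem HomogeneouslyDense.pow {Z : Type*} {K : ℝ} {ρ : Z → Z → ℝ} {l₁ l₂ : ℝ}
    (hρ : IsQuasiMetric K ρ) (hl₁ : 0 < l₁) (hl₂ : 0 ≤ l₂) (h : HomogeneouslyDense ρ l₁ l₂)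
    (n : ℕ) : HomogeneouslyDense ρ (l₁ ^ n) (l₂ ^ n) := by
  intro a b hab
  have hpos : 0 < ρ a b :=
    lt_of_le_of_ne (hρ.1 a b) fun h0 => hab ((hρ.2.1 a b).1 h0.symm)
  induction n with
  | zero => exact ⟨b, by simp, by simp⟩
  | succ n ih =>
    obtain ⟨y, hy₁, hy₂⟩ := ih
    have hay : a ≠ y := by
      intro hay
      have h0 := (hρ.2.1 a y).2 hay
      have : 0 < l₁ ^ n * ρ a b := by positivity
      linarith
    obtain ⟨x, hx₁, hx₂⟩ := h a y hay
    refine ⟨x, ?_, ?_⟩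
    · calc l₁ ^ (n + 1) * ρ a b = l₁ * (l₁ ^ n * ρ a b) := by ring
        _ ≤ l₁ * ρ a y := by gcongr
        _ ≤ ρ a x := hx₁
    · calc ρ a x ≤ l₂ * ρ a y := hx₂
        _ ≤ l₂ * (l₂ ^ n * ρ a b) := by gcongr
        _ = l₂ ^ (n + 1) * ρ a b := by ring

/-- quasisymmetric maps preserve homogeneous density, quantitatively. -/
theorem stmt15 (K l₁ l₂ : ℝ) (η : ℝ → ℝ) (hK : 1 ≤ K)
    (hl1 : 0 < l₁) (hl12 : l₁ ≤ l₂) (hl2 : l₂ < 1) (hη : ControlFun η) :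
    ∃ μ₁ μ₂ : ℝ, 0 < μ₁ ∧ μ₁ ≤ μ₂ ∧ μ₂ < 1 ∧
      ∀ {Z₁ : Type u} {Z₂ : Type v} (ρ₁ : Z₁ → Z₁ → ℝ) (ρ₂ : Z₂ → Z₂ → ℝ) (f : Z₁ → Z₂),
        IsQuasiMetric K ρ₁ → IsQuasiMetric K ρ₂ → Function.Bijective f →
        QuasiSymmetric ρ₁ ρ₂ f η → HomogeneouslyDense ρ₁ l₁ l₂ →
        HomogeneouslyDense ρ₂ μ₁ μ₂ := by
  obtain ⟨h0, hmono, -, hsurj⟩ := hη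
  have hl2' : 0 < l₂ := hl1.trans_le hl12
  obtain ⟨t, ht, hηt⟩ := hsurj (1 / 2) (by norm_num)
  have htpos : 0 < t := by
    refine lt_of_le_of_ne ht ?_
    rintro rfl
    norm_num [h0] at hηt
  obtain ⟨n, hn⟩ := exists_pow_lt_of_lt_one htpos hl2
  have hηn : η (l₂ ^ n) ≤ 1 / 2 :=
    hηt ▸ hmono.monotoneOn (Set.mem_Ici.2 (by positivity)) (Set.mem_Ici.2 ht) hn.le
  set C : ℝ := η ((l₁ ^ n)⁻¹) with hC
  have hCpos : 0 < C := by
    have := hmono (Set.mem_Ici.2 le_rfl) (Set.mem_Ici.2 (by positivity))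
      (show (0 : ℝ) < (l₁ ^ n)⁻¹ by positivity)
    rwa [h0] at this
  refine ⟨min (1 / 2) C⁻¹, 1 / 2, lt_min (by norm_num) (by positivity), min_le_left _ _,
    by norm_num, ?_⟩
  intro Z₁ Z₂ ρ₁ ρ₂ f hρ₁ hρ₂ hf hqs hd a' b' hab'
  obtain ⟨a, rfl⟩ := hf.2 a'
  obtain ⟨b, rfl⟩ := hf.2 b'
  have hab : a ≠ b := fun h => hab' (congrArg f h)
  have hpos : 0 < ρ₁ a b :=
    lt_of_le_of_ne (hρ₁.1 a b) fun h => hab ((hρ₁.2.1 a b).1 h.symm)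
  obtain ⟨x, hx₁, hx₂⟩ := hd.pow hρ₁ hl1 hl2'.le n a b hab
  have hax : a ≠ x := by
    intro hax
    have hzero := (hρ₁.2.1 a x).2 hax
    have : 0 < l₁ ^ n * ρ₁ a b := by positivity
    linarith
  have hnonneg := hρ₂.1 (f a) (f b)
  refine ⟨f x, ?_, ?_⟩
  · have hle : ρ₂ (f a) (f b) ≤ C * ρ₂ (f a) (f x) :=
      hqs a b x hax _ (by positivity) ((le_inv_mul_iff₀ (by positivity)).2 hx₁)
    calc min (1 / 2) C⁻¹ * ρ₂ (f a) (f b) ≤ C⁻¹ * ρ₂ (f a) (f b) := by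
          gcongr
          exact min_le_right _ _
      _ ≤ ρ₂ (f a) (f x) := (inv_mul_le_iff₀ hCpos).2 hle
  · calc ρ₂ (f a) (f x) ≤ η (l₂ ^ n) * ρ₂ (f a) (f b) :=
          hqs a x b hab _ (by positivity) hx₂
      _ ≤ 1 / 2 * ρ₂ (f a) (f b) := by gcongr
end

section
/- Let (Z₁,ρ₁) and (Z₂,ρ₂) be quasi-metric spaces (with quasi-metric coefficients K₁ and K₂ respectively) and let f : Z₁ → Z₂ be an η-quasisymmetric bijection. If (Z₁,ρ₁) is μ-uniformly perfect, then (Z₂,ρ₂) is μ'-uniformly perfect for a constant μ' ∈ (0,1) depending only on μ and η. -/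
open Filter Topology

universe u v

/-- quasisymmetric maps preserve uniform perfectness; `μ'` depends
only on `μ` and `η`. -/
theorem stmt16 (μ : ℝ) (η : ℝ → ℝ) (hμ0 : 0 < μ) (hμ1 : μ < 1) (hη : ControlFun η) :
    ∃ μ' : ℝ, 0 < μ' ∧ μ' < 1 ∧
      ∀ {Z₁ : Type u} {Z₂ : Type v} (K₁ K₂ : ℝ)
        (ρ₁ : Z₁ → Z₁ → ℝ) (ρ₂ : Z₂ → Z₂ → ℝ) (f : Z₁ → Z₂),
        1 ≤ K₁ → 1 ≤ K₂ → IsQuasiMetric K₁ ρ₁ → IsQuasiMetric K₂ ρ₂ →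
        Function.Bijective f → QuasiSymmetric ρ₁ ρ₂ f η →
        UniformlyPerfectWith ρ₁ μ → UniformlyPerfectWith ρ₂ μ' := by
  obtain ⟨η_zero, η_mono, -, η_surj⟩ := hη
  have η_pos : ∀ t : ℝ, 0 < t → 0 < η t := fun t ht => by
    simpa [η_zero] using η_mono (Set.mem_Ici.2 le_rfl) (Set.mem_Ici.2 ht.le) ht
  obtain ⟨t, ht, hηt⟩ := η_surj (1 / 2) (by norm_num)
  have ht_pos : 0 < t := ht.lt_of_ne (by rintro rfl; norm_num [η_zero] at hηt)
  obtain ⟨s, hs, hs1, hηs⟩ : ∃ s : ℝ, 0 < s ∧ s ≤ 1 ∧ η s ≤ 1 / 2 :=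
    ⟨min t 1, by positivity, min_le_right _ _, hηt ▸ η_mono.monotoneOn
      (Set.mem_Ici.2 (by positivity)) (Set.mem_Ici.2 ht) (min_le_left _ _)⟩
  have hB : 0 < η (1 / (μ * s)) := η_pos _ (by positivity)
  refine ⟨min (1 / 2) (1 / η (1 / (μ * s))), by positivity,
    (min_le_left _ _).trans_lt (by norm_num), ?_⟩
  intro Z₁ Z₂ K₁ K₂ ρ₁ ρ₂ f _ _ h₁ h₂ hf hqs hup x' r hr ⟨z', hz'⟩
  obtain ⟨x, rfl⟩ := hf.2 x'
  obtain ⟨z, rfl⟩ := hf.2 z'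
  by_contra! hgap
  have step : ∀ w : Z₁, r ≤ ρ₂ (f x) (f w) →
      ∃ y : Z₁, r ≤ ρ₂ (f x) (f y) ∧ ρ₂ (f x) (f y) ≤ 1 / 2 * ρ₂ (f x) (f w) := by
    intro w hw
    have hxw : x ≠ w := by
      rintro rfl
      linarith [(h₂.2.1 (f x) (f x)).2 rfl]
    have hpos : 0 < ρ₁ x w := (h₁.1 x w).lt_of_ne fun h => hxw ((h₁.2.1 x w).1 h.symm)
    obtain ⟨y, hy, hy'⟩ := hup x (s * ρ₁ x w) (by positivity)
      ⟨w, mul_le_of_le_one_left hpos.le hs1⟩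
    have hxy : x ≠ y := by
      rintro rfl
      rw [(h₁.2.1 x x).2 rfl] at hy
      exact hy.not_gt (by positivity)
    have upper := hqs x y w hxw s hs.le hy'.le
    have lower := hqs x w y hxy (1 / (μ * s)) (by positivity) (by
      rw [one_div, ← div_eq_inv_mul, le_div_iff₀ (by positivity)]
      linarith)
    refine ⟨y, hgap (f y) ?_, upper.trans (mul_le_mul_of_nonneg_right hηs (h₂.1 _ _))⟩
    calc min (1 / 2) (1 / η (1 / (μ * s))) * r ≤ 1 / η (1 / (μ * s)) * r := by
          gcongr; exact min_le_right _ _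
      _ = r / η (1 / (μ * s)) := by ring
      _ ≤ ρ₂ (f x) (f y) := by
          rw [div_le_iff₀ hB]
          linarith
  have iter : ∀ n : ℕ, ∃ y : Z₁, r ≤ ρ₂ (f x) (f y) ∧
      ρ₂ (f x) (f y) ≤ (1 / 2) ^ n * ρ₂ (f x) (f z) := by
    intro n
    induction n with
    | zero => exact ⟨z, hz', by simp⟩
    | succ n ih =>
      obtain ⟨w, hw, hwn⟩ := ih
      obtain ⟨y, hy, hyw⟩ := step w hw
      exact ⟨y, hy, by rw [pow_succ']; linarith⟩
  have hz_pos : 0 < ρ₂ (f x) (f z) := hr.trans_le hz'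
  obtain ⟨n, hn⟩ := exists_pow_lt_of_lt_one (div_pos hr hz_pos)
    (by norm_num : (1 / 2 : ℝ) < 1)
  obtain ⟨y, hy, hyn⟩ := iter n
  rw [lt_div_iff₀ hz_pos] at hn
  linarith
end
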